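/- Let $0 < r < p \le q < \infty$ with $r \le 1 \le q$, and let $u, v, w$ be weights on $(a,b)$ with $0 < \int_x^b w < \infty$ for all $x \in (a,b)$. Then the inequality $\big(\int_a^b \big(\int_a^t f^r v\big)^{q/r} u\,dt\big)^{1/q} \le C \big(\int_a^b \big(\int_a^t f\big)^{p} w\,dt\big)^{1/p}$ holds for all nonnegative measurable $f$ if and only if both $C_1 := \operatorname{ess\,sup}_{x\in(a,b)} \big(\int_x^b w\big)^{-1/p} \operatorname{ess\,sup}_{t\in(x,b)} \big(\int_t^b u\big)^{1/q} V_r(x,t)$ and $C_3 := \sup_{x\in(a,b)} \big(\int_x^b u\big)^{1/q} \big(\int_a^x \big(\int_t^b w\big)^{-p/(p-r)} w(t)\, V_r(t,x)^{pr/(p-r)}\, dt\big)^{(p-r)/(pr)}$ are finite; moreover the best constant satisfies $C \approx C_1 + C_3$. -/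

import Mathlib

open MeasureTheory Set ENNReal

noncomputable section

/-- `w` is a weight on `(a,b)`: measurable, positive and finite there. -/
def IsWeight (a b : ℝ) (w : ℝ → ℝ≥0∞) : Prop :=
  Measurable w ∧ ∀ x ∈ Set.Ioo a b, 0 < w x ∧ w x < ∞

/-- The quantity `V_r(x,t)`: `(∫_x^t v^{1/(1-r)})^{(1-r)/r}` for `0 < r < 1`,
and `ess sup_{(x,t)} v` for `r = 1`. -/
def Vr (r : ℝ) (v : ℝ → ℝ≥0∞) (x t : ℝ) : ℝ≥0∞ :=
  if r = 1 then essSup v (volume.restrict (Set.Ioo x t))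
  else (∫⁻ s in Set.Ioo x t, v s ^ (1 / (1 - r))) ^ ((1 - r) / r)

/-- The Cesàro–Cesàro inequality (2.2) with constant `C`:
`(∫_a^b (∫_a^t f^r v)^{q/r} u dt)^{1/q} ≤ C (∫_a^b (∫_a^t f)^p w dt)^{1/p}`
for all nonnegative measurable `f` on `(a,b)`. -/
def CesCesIneq (a b r p q : ℝ) (u v w : ℝ → ℝ≥0∞) (C : ℝ≥0∞) : Prop :=
  ∀ f : ℝ → ℝ≥0∞, Measurable f →
    (∫⁻ t in Set.Ioo a b, (∫⁻ s in Set.Ioo a t, f s ^ r * v s) ^ (q / r) * u t) ^ (1 / q) ≤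
      C * (∫⁻ t in Set.Ioo a b, (∫⁻ s in Set.Ioo a t, f s) ^ p * w t) ^ (1 / p)

/-- The best (least) constant in the Cesàro–Cesàro inequality. -/
def BestC (a b r p q : ℝ) (u v w : ℝ → ℝ≥0∞) : ℝ≥0∞ :=
  sInf {C | CesCesIneq a b r p q u v w C}

def C₁ (a b r p q : ℝ) (u v w : ℝ → ℝ≥0∞) : ℝ≥0∞ :=
  essSup (fun x => (∫⁻ t in Set.Ioo x b, w t) ^ (-(1 / p)) *
      essSup (fun t => (∫⁻ s in Set.Ioo t b, u s) ^ (1 / q) * Vr r v x t)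
        (volume.restrict (Set.Ioo x b)))
    (volume.restrict (Set.Ioo a b))

def C₂ (a b r p q : ℝ) (u v w : ℝ → ℝ≥0∞) : ℝ≥0∞ :=
  ⨆ x ∈ Set.Ioo a b, (∫⁻ t in Set.Ioo x b, w t) ^ (-(1 / p)) *
    (∫⁻ t in Set.Ioo x b,
        (∫⁻ s in Set.Ioo t b, u s) ^ (q / (1 - q)) * u t * Vr r v x t ^ (q / (1 - q))) ^
      ((1 - q) / q)

def C₃ (a b r p q : ℝ) (u v w : ℝ → ℝ≥0∞) : ℝ≥0∞ :=
  ⨆ x ∈ Set.Ioo a b, (∫⁻ t in Set.Ioo x b, u t) ^ (1 / q) *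
    (∫⁻ t in Set.Ioo a x,
        (∫⁻ s in Set.Ioo t b, w s) ^ (-(p / (p - r))) * w t * Vr r v t x ^ (p * r / (p - r))) ^
      ((p - r) / (p * r))

def C₄ (a b r p q : ℝ) (u v w : ℝ → ℝ≥0∞) : ℝ≥0∞ :=
  (∫⁻ x in Set.Ioo a b, (∫⁻ s in Set.Ioo x b, u s) ^ (q / (p - q)) * u x *
      essSup (fun t => (∫⁻ s in Set.Ioo t b, w s) ^ (-(q / (p - q))) *
          Vr r v t x ^ (p * q / (p - q)))
        (volume.restrict (Set.Ioo a x))) ^ ((p - q) / (p * q))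

def C₅ (a b r p q : ℝ) (u v w : ℝ → ℝ≥0∞) : ℝ≥0∞ :=
  (∫⁻ x in Set.Ioo a b, w x *
      ⨆ y ∈ Set.Ioo a x, (∫⁻ s in Set.Ioo y b, w s) ^ (-(p / (p - q))) *
        (∫⁻ t in Set.Ioo y x,
            (∫⁻ s in Set.Ioo t x, u s) ^ (q / (1 - q)) * u t * Vr r v y t ^ (q / (1 - q))) ^
          (p * (1 - q) / (p - q))) ^ ((p - q) / (p * q))

def C₆ (a b r p q : ℝ) (u v w : ℝ → ℝ≥0∞) : ℝ≥0∞ :=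
  (∫⁻ x in Set.Ioo a b, w x *
      essSup (fun y => (∫⁻ s in Set.Ioo y b, w s)⁻¹ *
          (∫⁻ t in Set.Ioo y x, (∫⁻ s in Set.Ioo t b, u s) ^ (q / (p - q)) * u t *
              (∫⁻ s in Set.Ioo a y, (∫⁻ σ in Set.Ioo s b, w σ) ^ (-(p / (p - r))) * w s *
                  Vr r v s y ^ (p * r / (p - r))) ^ ((p - r) * q / ((p - q) * r))))
        (volume.restrict (Set.Ioo a x))) ^ ((p - q) / (p * q))

def C₇ (a b r p q : ℝ) (u v w : ℝ → ℝ≥0∞) : ℝ≥0∞ :=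
  (∫⁻ x in Set.Ioo a b, w x *
      essSup (fun y => (∫⁻ s in Set.Ioo y b, w s) ^ (-(p / (p - q))) *
          essSup (fun t => (∫⁻ s in Set.Ioo t x, u s) ^ (p / (p - q)) *
              Vr r v y t ^ (p * q / (p - q)))
            (volume.restrict (Set.Ioo y x)))
        (volume.restrict (Set.Ioo a x))) ^ ((p - q) / (p * q))

lemma two_rpow_add (x y : ℝ) : (2 : ℝ≥0∞) ^ (x + y) = 2 ^ x * 2 ^ y :=
  ENNReal.rpow_add x y two_ne_zero ofNat_ne_top

lemma two_rpow_ne_zero (x : ℝ) : (2 : ℝ≥0∞) ^ x ≠ 0 := by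
  simp [ENNReal.rpow_eq_zero_iff]

lemma two_rpow_ne_top (x : ℝ) : (2 : ℝ≥0∞) ^ x ≠ ∞ := by
  simp [ENNReal.rpow_eq_top_iff]

lemma two_rpow_mono {x y : ℝ} (h : x ≤ y) : (2 : ℝ≥0∞) ^ x ≤ 2 ^ y :=
  ENNReal.rpow_le_rpow_of_exponent_le one_le_two h

lemma tsum_two_rpow_neg_lt_top {ε : ℝ} (hε : 0 < ε) :
    ∑' j : ℕ, (2 : ℝ≥0∞) ^ (-(ε * j)) < ∞ := by
  have h : ∀ j : ℕ, (2 : ℝ≥0∞) ^ (-(ε * j)) = (2 ^ (-ε)) ^ j := fun j => by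
    rw [← ENNReal.rpow_natCast, ← ENNReal.rpow_mul]; ring_nf
  simp_rw [h, ENNReal.tsum_geometric]
  rw [ENNReal.inv_lt_top, tsub_pos_iff_lt]
  exact ENNReal.rpow_lt_one_of_one_lt_of_neg one_lt_two (by linarith)

/-- A sum is dominated by a geometrically weighted supremum. -/
lemma tsum_le_mul_iSup (y : ℕ → ℝ≥0∞) (ε : ℝ) :
    ∑' j, y j ≤ (∑' j : ℕ, (2 : ℝ≥0∞) ^ (-(ε * j))) * ⨆ j : ℕ, 2 ^ (ε * j) * y j := by
  rw [← ENNReal.tsum_mul_right]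
  refine ENNReal.tsum_le_tsum fun j => ?_
  calc y j = 2 ^ (-(ε * j)) * (2 ^ (ε * j) * y j) := by
        rw [← mul_assoc, ← two_rpow_add]; simp
    _ ≤ _ := by gcongr; exact le_iSup (fun j : ℕ => (2 : ℝ≥0∞) ^ (ε * j) * y j) j

/-- `V_r` over an arbitrary set. -/
def vrOn (r : ℝ) (v : ℝ → ℝ≥0∞) (E : Set ℝ) : ℝ≥0∞ :=
  if r = 1 then essSup v (volume.restrict E)
  else (∫⁻ s in E, v s ^ (1 / (1 - r))) ^ ((1 - r) / r)

lemma Vr_eq_vrOn (r : ℝ) (v : ℝ → ℝ≥0∞) (x t : ℝ) : Vr r v x t = vrOn r v (Ioo x t) := rfl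

section vrOn

variable {r : ℝ} {v : ℝ → ℝ≥0∞}

lemma vrOn_mono (hr0 : 0 < r) (hr1 : r ≤ 1) {E F : Set ℝ} (h : E ⊆ F) :
    vrOn r v E ≤ vrOn r v F := by
  unfold vrOn
  split_ifs with hr
  · exact essSup_mono_measure (Measure.restrict_mono h le_rfl).absolutelyContinuous
  · exact ENNReal.rpow_le_rpow (lintegral_mono_set h) (div_nonneg (by linarith) hr0.le)

lemma vrOn_empty (hr0 : 0 < r) (hr1 : r ≤ 1) : vrOn r v ∅ = 0 := by
  unfold vrOn
  split_ifs with hr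
  · simp
  · have : 0 < 1 - r := sub_pos.2 (lt_of_le_of_ne hr1 hr)
    simp [ENNReal.zero_rpow_of_pos (div_pos this hr0)]

lemma vrOn_iUnion_le_of_monotone (hr0 : 0 < r) (hr1 : r ≤ 1) {E : ℕ → Set ℝ} (hE : Monotone E)
    {M : ℝ≥0∞} (h : ∀ i, vrOn r v (E i) ≤ M) : vrOn r v (⋃ i, E i) ≤ M := by
  unfold vrOn at *
  split_ifs with hr
  · simp only [hr, if_true] at h
    refine essSup_le_of_ae_le _ ?_
    refine (ae_restrict_iUnion_iff _ _).2 fun i => ?_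
    filter_upwards [_root_.ae_le_essSup (f := v) (μ := volume.restrict (E i))] with x hx
    exact hx.trans (h i)
  · simp only [hr, if_false] at h
    have h1 : 0 < 1 - r := sub_pos.2 (lt_of_le_of_ne hr1 hr)
    have h2 : 0 < (1 - r) / r := div_pos h1 hr0
    rw [← ENNReal.le_rpow_inv_iff h2, setLIntegral_iUnion_of_directed _ hE.directed_le]
    exact iSup_le fun i => (ENNReal.le_rpow_inv_iff h2).2 (h i)

lemma exists_vrOn_iUnion_le (hr0 : 0 < r) (hr1 : r ≤ 1) {ε : ℝ} (hε : 0 < ε) :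
    ∃ K : ℝ≥0∞, K < ∞ ∧ ∀ (v : ℝ → ℝ≥0∞) (E : ℕ → Set ℝ),
      vrOn r v (⋃ j, E j) ≤ K * ⨆ j : ℕ, 2 ^ (ε * j) * vrOn r v (E j) := by
  by_cases hr : r = 1
  · refine ⟨1, one_lt_top, fun v E => ?_⟩
    simp only [vrOn, hr, if_true, one_mul]
    refine essSup_le_of_ae_le _ ((ae_restrict_iUnion_iff _ _).2 fun i => ?_)
    filter_upwards [_root_.ae_le_essSup (f := v) (μ := volume.restrict (E i))] with x hx
    refine hx.trans (le_iSup_of_le i ?_)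
    refine le_mul_of_one_le_left' ?_
    simpa using two_rpow_mono (show (0 : ℝ) ≤ ε * i by positivity)
  · have h1 : 0 < 1 - r := sub_pos.2 (lt_of_le_of_ne hr1 hr)
    have h2 : 0 < (1 - r) / r := div_pos h1 hr0
    have h3 : 0 < ε * (r / (1 - r)) := mul_pos hε (div_pos hr0 h1)
    refine ⟨(∑' j : ℕ, (2 : ℝ≥0∞) ^ (-(ε * (r / (1 - r)) * j))) ^ ((1 - r) / r),
      ENNReal.rpow_lt_top_of_nonneg h2.le (tsum_two_rpow_neg_lt_top h3).ne, fun v E => ?_⟩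
    simp only [vrOn, hr, if_false]
    refine (ENNReal.rpow_le_rpow ((lintegral_iUnion_le _ _).trans
      (tsum_le_mul_iSup _ (ε * (r / (1 - r))))) h2.le).trans ?_
    rw [ENNReal.mul_rpow_of_nonneg _ _ h2.le]
    refine mul_le_mul_right ?_ _
    rw [← ENNReal.le_rpow_inv_iff h2]
    refine iSup_le fun j => (ENNReal.le_rpow_inv_iff h2).2 ?_
    refine le_iSup_of_le j ?_
    rw [ENNReal.mul_rpow_of_nonneg _ _ h2.le, ← ENNReal.rpow_mul]
    have : ε * (r / (1 - r)) * j * ((1 - r) / r) = ε * j := by field_simp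
    rw [this]

lemma setLIntegral_rpow_mul_le (hr0 : 0 < r) (hr1 : r ≤ 1) (hv : Measurable v)
    {f : ℝ → ℝ≥0∞} (hf : Measurable f) (E : Set ℝ) :
    ∫⁻ s in E, f s ^ r * v s ≤ (∫⁻ s in E, f s) ^ r * vrOn r v E ^ r := by
  by_cases hr : r = 1
  · subst hr
    simp only [vrOn, if_true, ENNReal.rpow_one]
    rw [← lintegral_mul_const _ hf]
    refine lintegral_mono_ae ?_
    filter_upwards [_root_.ae_le_essSup (f := v) (μ := volume.restrict E)] with x hx
    gcongr
  · have h1 : 0 < 1 - r := sub_pos.2 (lt_of_le_of_ne hr1 hr)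
    have hc : (1 / r).HolderConjugate (1 / (1 - r)) := by
      rw [Real.holderConjugate_iff]
      refine ⟨by rw [lt_div_iff₀ hr0]; linarith, by simp⟩
    refine (ENNReal.lintegral_mul_le_Lp_mul_Lq (volume.restrict E) hc
      (f := fun s => f s ^ r) (g := v) (by fun_prop) hv.aemeasurable).trans ?_
    simp only [vrOn, hr, if_false, ← ENNReal.rpow_mul]
    apply le_of_eq
    congr 2
    · simp [hr0.ne']
    · simp
    · field_simp

lemma vrOn_le_of_forall (hr0 : 0 < r) (hr1 : r ≤ 1) (hv : Measurable v) {E : Set ℝ}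
    (hE : MeasurableSet E) (hE' : volume E ≠ ∞) (hvE : ∀ x ∈ E, v x < ∞) {M : ℝ≥0∞}
    (h : ∀ g : ℝ → ℝ≥0∞, Measurable g →
      (∫⁻ s in E, g s ^ r * v s) ^ (1 / r) ≤ M * ∫⁻ s in E, g s) : vrOn r v E ≤ M := by
  by_cases hr : r = 1
  · subst hr
    simp only [vrOn, if_true]
    refine essSup_le_of_ae_le _ (ae_le_of_forall_setLIntegral_le_of_sigmaFinite hv ?_)
    intro s hs _
    have := h (s.indicator 1) (measurable_one.indicator hs)
    simp only [ENNReal.rpow_one, div_one] at this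
    have e : (fun x => s.indicator (1 : ℝ → ℝ≥0∞) x * v x) = s.indicator v := by
      ext x; by_cases hx : x ∈ s <;> simp [hx]
    rw [e, lintegral_indicator hs, lintegral_indicator_one hs] at this
    simpa using this
  · have h1 : 0 < 1 - r := sub_pos.2 (lt_of_le_of_ne hr1 hr)
    have hU : E = ⋃ i : ℕ, E ∩ {x | v x ≤ i} := by
      ext x
      simp only [mem_iUnion, mem_inter_iff, mem_ofPred_eq, exists_and_left, iff_self_and]
      intro hx
      obtain ⟨n, hn⟩ := ENNReal.exists_nat_gt (hvE x hx).ne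
      exact ⟨n, hn.le⟩
    rw [hU]
    refine vrOn_iUnion_le_of_monotone hr0 hr1 ?_ fun i => ?_
    · intro i j hij x hx
      exact ⟨hx.1, le_trans (show v x ≤ i from hx.2) (by exact_mod_cast hij)⟩
    · have hm : MeasurableSet {x | v x ≤ i} := measurableSet_le hv measurable_const
      have key := h ({x | v x ≤ i}.indicator fun x => v x ^ (1 / (1 - r)))
        ((hv.pow_const _).indicator hm)
      have e : (fun x => {x | v x ≤ i}.indicator (fun x => v x ^ (1 / (1 - r))) x ^ r * v x) =
          {x | v x ≤ i}.indicator fun x => v x ^ (1 / (1 - r)) := by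
        ext x
        by_cases hx : x ∈ {x | v x ≤ i}
        · simp only [indicator_of_mem hx]
          rw [← ENNReal.rpow_mul]
          nth_rw 2 [← ENNReal.rpow_one (v x)]
          rw [← ENNReal.rpow_add_of_nonneg _ _ (by positivity) zero_le_one]
          congr 1
          field_simp
          ring
        · simp [indicator_of_notMem hx, ENNReal.zero_rpow_of_pos hr0]
      rw [e, lintegral_indicator hm, Measure.restrict_restrict hm, inter_comm] at key
      simp only [vrOn, hr, if_false]
      set J := ∫⁻ x in E ∩ {x | v x ≤ i}, v x ^ (1 / (1 - r)) with hJ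
      have hJt : J ≠ ∞ := by
        have : J ≤ ∫⁻ x in E ∩ {x | v x ≤ i}, (i : ℝ≥0∞) ^ (1 / (1 - r)) :=
          setLIntegral_mono' (hE.inter hm) fun x hx =>
            ENNReal.rpow_le_rpow hx.2 (by positivity)
        refine ne_top_of_le_ne_top ?_ this
        rw [setLIntegral_const]
        refine ENNReal.mul_ne_top (ENNReal.rpow_ne_top_of_nonneg (by positivity) (by simp)) ?_
        exact ne_top_of_le_ne_top hE' (measure_mono inter_subset_left)
      rcases eq_or_ne J 0 with h0 | h0
      · rw [h0, ENNReal.zero_rpow_of_pos (by positivity)]; exact zero_le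
      · have : (1 - r) / r = 1 / r - 1 := by field_simp
        rw [this, ENNReal.rpow_sub _ _ h0 hJt, ENNReal.rpow_one]
        exact ENNReal.div_le_of_le_mul key

end vrOn

lemma setLIntegral_Ioo_add (h : ℝ → ℝ≥0∞) {a x b : ℝ} (hax : a < x) (hxb : x < b) :
    ∫⁻ t in Ioo a b, h t = (∫⁻ t in Ioo a x, h t) + ∫⁻ t in Ioo x b, h t := by
  rw [← Ioc_union_Ioo_eq_Ioo hax.le hxb, lintegral_union measurableSet_Ioo,
    ← restrict_Ioo_eq_restrict_Ioc]
  exact Set.disjoint_left.2 fun t ht ht' => not_lt.2 ht.2 ht'.1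

lemma exists_setLIntegral_Ioo_eq {h : ℝ → ℝ≥0∞} (hh : Measurable h) {a b : ℝ}
    (hfin : ∫⁻ t in Ioo a b, h t ≠ ∞) {c : ℝ≥0∞} (hc0 : 0 < c) (hc : c < ∫⁻ t in Ioo a b, h t) :
    ∃ x ∈ Ioo a b, ∫⁻ t in Ioo a x, h t = c := by
  have hab : a < b := by
    by_contra hab
    rw [Ioo_eq_empty hab] at hc
    simp at hc
  set g : ℝ → ℝ := fun s => ((Ioo a b).indicator h s).toReal with hg
  have hgi : Integrable g := by
    refine integrable_toReal_of_lintegral_ne_top (hh.indicator measurableSet_Ioo).aemeasurable ?_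
    rwa [lintegral_indicator measurableSet_Ioo]
  have hG : ∀ x ∈ Icc a b, ∫ s in a..x, g s = (∫⁻ t in Ioo a x, h t).toReal := by
    intro x hx
    rw [intervalIntegral.integral_of_le hx.1, ← restrict_Ioo_eq_restrict_Ioc,
      integral_toReal (hh.indicator measurableSet_Ioo).aemeasurable]
    · congr 1
      refine setLIntegral_congr_fun measurableSet_Ioo fun t ht => ?_
      exact indicator_of_mem (Ioo_subset_Ioo_right hx.2 ht) h
    · refine ae_restrict_of_ae (ae_lt_top (hh.indicator measurableSet_Ioo) ?_)
      rwa [lintegral_indicator measurableSet_Ioo]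
  have hcont : Continuous fun x => ∫ s in a..x, g s :=
    intervalIntegral.continuous_primitive (fun _ _ => hgi.intervalIntegrable) a
  have hct : c ≠ ∞ := ne_top_of_lt hc
  obtain ⟨x, hx, hxc⟩ := intermediate_value_Icc hab.le hcont.continuousOn
    (show c.toReal ∈ _ from by
      simp only [intervalIntegral.integral_same]
      rw [hG b (right_mem_Icc.2 hab.le)]
      exact ⟨toReal_nonneg, toReal_mono hfin hc.le⟩)
  simp only [hG x hx] at hxc
  have hxt : ∫⁻ t in Ioo a x, h t ≠ ∞ :=
    ne_top_of_le_ne_top hfin (lintegral_mono_set (Ioo_subset_Ioo_right hx.2))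
  have hxc' : ∫⁻ t in Ioo a x, h t = c := (toReal_eq_toReal_iff' hxt hct).1 hxc
  refine ⟨x, ⟨lt_of_le_of_ne hx.1 ?_, lt_of_le_of_ne hx.2 ?_⟩, hxc'⟩
  · rintro rfl
    simp at hxc'
    exact hc0.ne hxc'
  · rintro rfl
    exact hc.ne hxc'.symm

/-- Mass of a set all of whose right tails are small. -/
lemma setLIntegral_le_of_tail_le {h : ℝ → ℝ≥0∞} {a b : ℝ} {c : ℝ≥0∞} {S : Set ℝ}
    (hS : S ⊆ Ioo a b) (hc : ∀ t ∈ S, ∫⁻ s in Ioo t b, h s ≤ c) : ∫⁻ s in S, h s ≤ c := by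
  rcases S.eq_empty_or_nonempty with rfl | hne
  · simp
  have hbd : BddBelow S := ⟨a, fun x hx => (hS hx).1.le⟩
  obtain ⟨t, hanti, htend, htS⟩ := exists_seq_tendsto_sInf hne hbd
  have h1 : S ⊆ Ico (sInf S) b := fun x hx => ⟨csInf_le hbd hx, (hS hx).2⟩
  have h2 : Ioo (sInf S) b ⊆ ⋃ i, Ioo (t i) b := by
    intro x hx
    obtain ⟨i, hi⟩ := (htend.eventually (gt_mem_nhds hx.1)).exists
    exact mem_iUnion.2 ⟨i, hi, hx.2⟩
  calc ∫⁻ s in S, h s ≤ ∫⁻ s in Ico (sInf S) b, h s := lintegral_mono_set h1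
    _ = ∫⁻ s in Ioo (sInf S) b, h s := by rw [restrict_Ioo_eq_restrict_Ico]
    _ ≤ ∫⁻ s in ⋃ i, Ioo (t i) b, h s := lintegral_mono_set h2
    _ = ⨆ i, ∫⁻ s in Ioo (t i) b, h s := by
        refine setLIntegral_iUnion_of_directed _ (Monotone.directed_le ?_)
        exact fun i j hij => Ioo_subset_Ioo_left (hanti hij)
    _ ≤ c := iSup_le fun i => hc _ (htS i)

/-- Dyadic level sets of the tail `x ↦ ∫_x^b w`. -/
def tailLevel (a b : ℝ) (w : ℝ → ℝ≥0∞) (n : ℤ) : Set ℝ :=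
  {t | t ∈ Ioo a b ∧ (2 : ℝ≥0∞) ^ (-(n : ℝ) - 1) < ∫⁻ s in Ioo t b, w s ∧
    ∫⁻ s in Ioo t b, w s ≤ 2 ^ (-(n : ℝ))}

section tailLevel

variable {a b : ℝ} {w : ℝ → ℝ≥0∞}

lemma tail_antitone : Antitone fun t => ∫⁻ s in Ioo t b, w s :=
  fun _ _ h => lintegral_mono_set (Ioo_subset_Ioo_left h)

lemma tailLevel_subset (n : ℤ) : tailLevel a b w n ⊆ Ioo a b := fun _ h => h.1

lemma measurableSet_tailLevel (n : ℤ) : MeasurableSet (tailLevel a b w n) :=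
  measurableSet_Ioo.inter ((measurableSet_lt measurable_const tail_antitone.measurable).inter
    (measurableSet_le tail_antitone.measurable measurable_const))

lemma lt_of_mem_tailLevel {m n : ℤ} (hmn : m < n) {s t : ℝ} (hs : s ∈ tailLevel a b w m)
    (ht : t ∈ tailLevel a b w n) : s < t := by
  by_contra! hst
  have h1 : (2 : ℝ≥0∞) ^ (-(m : ℝ) - 1) < 2 ^ (-(n : ℝ)) :=
    hs.2.1.trans_le ((tail_antitone hst).trans ht.2.2)
  have h2 : (m : ℝ) + 1 ≤ n := by exact_mod_cast hmn
  exact absurd (two_rpow_mono (show -(n : ℝ) ≤ -(m : ℝ) - 1 by linarith)) (not_le.2 h1)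

lemma tailLevel_disjoint : Pairwise (Function.onFun Disjoint (tailLevel a b w)) := by
  intro m n hmn
  refine Set.disjoint_left.2 fun t hm hn => ?_
  rcases hmn.lt_or_gt with h | h
  · exact (lt_of_mem_tailLevel h hm hn).false
  · exact (lt_of_mem_tailLevel h hn hm).false

lemma exists_mem_tailLevel {t : ℝ} (ht : t ∈ Ioo a b) (h0 : 0 < ∫⁻ s in Ioo t b, w s)
    (h1 : ∫⁻ s in Ioo t b, w s < ∞) : ∃ n, t ∈ tailLevel a b w n := by
  obtain ⟨n, hn⟩ := ENNReal.exists_mem_Ioc_zpow h0.ne' h1.ne one_lt_two ofNat_ne_top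
  rw [← ENNReal.rpow_intCast, ← ENNReal.rpow_intCast] at hn
  have e₁ : -((-(n + 1) : ℤ) : ℝ) - 1 = n := by push_cast; ring
  have e₂ : -((-(n + 1) : ℤ) : ℝ) = ((n + 1 : ℤ) : ℝ) := by push_cast; ring
  refine ⟨-(n + 1), ht, ?_, ?_⟩
  · rw [e₁]; exact hn.1
  · rw [e₂]; exact hn.2

lemma iUnion_tailLevel
    (hw : ∀ x ∈ Ioo a b, 0 < (∫⁻ t in Ioo x b, w t) ∧ (∫⁻ t in Ioo x b, w t) < ∞) :
    ⋃ n, tailLevel a b w n = Ioo a b := by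
  refine Subset.antisymm (iUnion_subset tailLevel_subset) fun t ht => ?_
  exact mem_iUnion.2 (exists_mem_tailLevel ht (hw t ht).1 (hw t ht).2)

lemma setLIntegral_tailLevel_le (n : ℤ) :
    ∫⁻ t in tailLevel a b w n, w t ≤ 2 ^ (-(n : ℝ)) :=
  setLIntegral_le_of_tail_le (tailLevel_subset n) fun _ h => h.2.2

lemma setLIntegral_eq_tsum_tailLevel
    (hw : ∀ x ∈ Ioo a b, 0 < (∫⁻ t in Ioo x b, w t) ∧ (∫⁻ t in Ioo x b, w t) < ∞)
    {E : Set ℝ} (hE : MeasurableSet E) (hE' : E ⊆ Ioo a b) (h : ℝ → ℝ≥0∞) :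
    ∫⁻ t in E, h t = ∑' n, ∫⁻ t in E ∩ tailLevel a b w n, h t := by
  rw [← lintegral_iUnion (fun n => hE.inter (measurableSet_tailLevel n)), ← inter_iUnion,
    iUnion_tailLevel hw, inter_eq_left.2 hE']
  exact fun m n hmn => (tailLevel_disjoint hmn).mono inter_subset_right inter_subset_right

lemma exists_tail_eq (hwm : Measurable w) {y : ℝ} (h1 : ∫⁻ s in Ioo y b, w s < ∞) {c : ℝ≥0∞}
    (hc0 : 0 < c) (hc : c < ∫⁻ s in Ioo y b, w s) :
    ∃ x ∈ Ioo y b, ∫⁻ s in Ioo x b, w s = c := by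
  obtain ⟨x, hx, hxc⟩ := exists_setLIntegral_Ioo_eq hwm h1.ne
    (c := (∫⁻ s in Ioo y b, w s) - c) (tsub_pos_iff_lt.2 hc)
    (ENNReal.sub_lt_self h1.ne (hc0.trans hc).ne' hc0.ne')
  refine ⟨x, hx, ?_⟩
  have h2 := setLIntegral_Ioo_add w hx.1 hx.2
  rw [hxc] at h2
  have h3 : (∫⁻ s in Ioo y b, w s) - c ≠ ∞ := ENNReal.sub_ne_top h1.ne
  have h4 : (∫⁻ s in Ioo y b, w s) - c + c = ∫⁻ s in Ioo y b, w s := tsub_add_cancel_of_le hc.le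
  rw [← h4] at h2
  exact ((ENNReal.add_right_inj h3).1 (by simpa [h4] using h2)).symm

lemma le_setLIntegral_tailLevel (hww : IsWeight a b w)
    (hw : ∀ x ∈ Ioo a b, 0 < (∫⁻ t in Ioo x b, w t) ∧ (∫⁻ t in Ioo x b, w t) < ∞)
    {m : ℤ} {y : ℝ} (hy : y ∈ Ioo a b) (hm : (2 : ℝ≥0∞) ^ (-(m : ℝ)) < ∫⁻ t in Ioo y b, w t) :
    (2 : ℝ≥0∞) ^ (-(m : ℝ) - 1) ≤ ∫⁻ t in tailLevel a b w m, w t := by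
  obtain ⟨x₁, hx₁, h₁⟩ := exists_tail_eq hww.1 (hw y hy).2
    (pos_iff_ne_zero.2 (two_rpow_ne_zero _)) hm
  have hx₁' : x₁ ∈ Ioo a b := ⟨hy.1.trans hx₁.1, hx₁.2⟩
  have hhalf : (2 : ℝ≥0∞) ^ (-(m : ℝ)) = 2 ^ (-(m : ℝ) - 1) + 2 ^ (-(m : ℝ) - 1) := by
    rw [← mul_two]
    conv_lhs => rw [← sub_add_cancel (-(m : ℝ)) 1, two_rpow_add, ENNReal.rpow_one]
  have hlt : (2 : ℝ≥0∞) ^ (-(m : ℝ) - 1) < ∫⁻ t in Ioo x₁ b, w t := by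
    rw [h₁, hhalf]
    exact ENNReal.lt_add_right (two_rpow_ne_top _) (two_rpow_ne_zero _)
  obtain ⟨x₂, hx₂, h₂⟩ := exists_tail_eq hww.1 (hw x₁ hx₁').2
    (pos_iff_ne_zero.2 (two_rpow_ne_zero _)) hlt
  have hsplit := setLIntegral_Ioo_add w hx₂.1 hx₂.2
  rw [h₁, h₂, hhalf] at hsplit
  rw [(ENNReal.add_left_inj (two_rpow_ne_top _)).1 hsplit]
  refine lintegral_mono_set fun t ht => ⟨⟨hx₁'.1.trans ht.1, ht.2.trans hx₂.2⟩, ?_, ?_⟩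
  · rw [setLIntegral_Ioo_add w ht.2 hx₂.2, h₂, add_comm]
    refine ENNReal.lt_add_right (two_rpow_ne_top _) (ne_of_gt ?_)
    rw [setLIntegral_pos_iff hww.1]
    have : Function.support w ∩ Ioo t x₂ = Ioo t x₂ := by
      refine inter_eq_right.2 fun s hs => ?_
      exact (hww.2 s ⟨(hx₁'.1.trans ht.1).trans hs.1, hs.2.trans hx₂.2⟩).1.ne'
    rw [this]
    simpa using ht.2
  · exact (tail_antitone ht.1.le).trans h₁.le

end tailLevel

lemma tsum_rpow_le_rpow_tsum {ι : Type*} (x : ι → ℝ≥0∞) {s : ℝ} (hs : 1 ≤ s) :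
    ∑' i, x i ^ s ≤ (∑' i, x i) ^ s := by
  have e : ∀ y : ℝ≥0∞, y ^ s = y * y ^ (s - 1) := fun y => by
    nth_rw 2 [← ENNReal.rpow_one y]
    rw [← ENNReal.rpow_add_of_nonneg _ _ zero_le_one (by linarith)]
    congr 1; ring
  rw [e (∑' i, x i), ← ENNReal.tsum_mul_right]
  refine ENNReal.tsum_le_tsum fun i => ?_
  rw [e]
  exact mul_le_mul_right (ENNReal.rpow_le_rpow (ENNReal.le_tsum i) (by linarith)) _

lemma tsum_mul_le_Lp_mul_Lq {ι : Type*} (f g : ι → ℝ≥0∞) {p q : ℝ} (hpq : p.HolderConjugate q) :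
    ∑' i, f i * g i ≤ (∑' i, f i ^ p) ^ (1 / p) * (∑' i, g i ^ q) ^ (1 / q) := by
  rw [ENNReal.tsum_eq_iSup_sum]
  refine iSup_le fun s => (ENNReal.inner_le_Lp_mul_Lq s f g hpq).trans ?_
  gcongr
  · exact one_div_nonneg.2 hpq.nonneg
  · exact ENNReal.sum_le_tsum s
  · exact one_div_nonneg.2 hpq.symm.nonneg
  · exact ENNReal.sum_le_tsum s

lemma add_add_rpow_le (x y z : ℝ≥0∞) {s : ℝ} (hs : 0 ≤ s) :
    (x + y + z) ^ s ≤ 3 ^ s * (x ^ s + y ^ s + z ^ s) := by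
  set m := max (max x y) z with hm
  have h1 : x + y + z ≤ 3 * m := by
    calc x + y + z ≤ m + m + m := by
          gcongr
          · exact le_max_of_le_left (le_max_left _ _)
          · exact le_max_of_le_left (le_max_right _ _)
          · exact le_max_right _ _
      _ = 3 * m := by ring
  refine (ENNReal.rpow_le_rpow h1 hs).trans ?_
  rw [ENNReal.mul_rpow_of_nonneg _ _ hs]
  gcongr
  rcases max_choice (max x y) z with h | h
  · rcases max_choice x y with h' | h'
    · rw [hm, h, h']; exact le_add_right le_self_add
    · rw [hm, h, h']; exact le_add_right le_add_self
  · rw [hm, h]; exact le_add_self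

/-- Discrete Hardy inequality with geometric weights, in supremum form. -/
lemma tsum_two_rpow_mul_iSup_le {θ : ℝ} (z : ℤ → ℝ≥0∞) :
    ∑' n : ℤ, (2 : ℝ≥0∞) ^ (θ * n) * ⨆ j : ℕ, 2 ^ (θ / 2 * j) * z (n + j) ≤
      (∑' j : ℕ, (2 : ℝ≥0∞) ^ (-(θ / 2 * j))) * ∑' n : ℤ, 2 ^ (θ * n) * z n := by
  calc ∑' n : ℤ, (2 : ℝ≥0∞) ^ (θ * n) * ⨆ j : ℕ, 2 ^ (θ / 2 * j) * z (n + j)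
      ≤ ∑' n : ℤ, ∑' j : ℕ, (2 : ℝ≥0∞) ^ (-(θ / 2 * j)) *
          (2 ^ (θ * ((n + j : ℤ) : ℝ)) * z (n + j)) := by
        refine ENNReal.tsum_le_tsum fun n => ?_
        rw [ENNReal.mul_iSup]
        refine iSup_le fun j => ?_
        refine le_trans (le_of_eq ?_) (ENNReal.le_tsum j)
        rw [← mul_assoc, ← mul_assoc, ← two_rpow_add, ← two_rpow_add]
        congr 2
        push_cast; ring
    _ = ∑' j : ℕ, ∑' n : ℤ, (2 : ℝ≥0∞) ^ (-(θ / 2 * j)) *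
          (2 ^ (θ * ((n + j : ℤ) : ℝ)) * z (n + j)) := ENNReal.tsum_comm
    _ = _ := by
        rw [← ENNReal.tsum_mul_right]
        congr 1; ext j
        rw [ENNReal.tsum_mul_left]
        congr 1
        exact (Equiv.addRight (j : ℤ)).tsum_eq fun n : ℤ => (2 : ℝ≥0∞) ^ (θ * n) * z n

lemma exists_mem_Ioo_of_ae {a b c d : ℝ} (hcd : c < d) (hac : a ≤ c) (hdb : d ≤ b) {P : ℝ → Prop}
    (h : ∀ᵐ x ∂volume.restrict (Ioo a b), P x) : ∃ x ∈ Ioo c d, P x := by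
  refine Measure.exists_mem_of_measure_ne_zero_of_ae (μ := volume) (s := Ioo c d) ?_ ?_
  · simpa using hcd
  · exact ae_mono (Measure.restrict_mono (Ioo_subset_Ioo hac hdb) le_rfl) h

lemma tail_weight_pos {a b : ℝ} {u : ℝ → ℝ≥0∞} (hu : IsWeight a b u) {t : ℝ} (ht : t ∈ Ioo a b) :
    0 < ∫⁻ s in Ioo t b, u s := by
  rw [setLIntegral_pos_iff hu.1]
  have : Function.support u ∩ Ioo t b = Ioo t b :=
    inter_eq_right.2 fun s hs => (hu.2 s ⟨ht.1.trans hs.1, hs.2⟩).1.ne'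
  rw [this]
  simpa using ht.2

lemma mul_Vr_le_C₁ {a b r p q : ℝ} {u v w : ℝ → ℝ≥0∞} (hr0 : 0 < r) (hr1 : r ≤ 1)
    (hp : 0 < p) (hq : 0 < q) (hu : IsWeight a b u)
    (hw : ∀ x ∈ Ioo a b, 0 < (∫⁻ t in Ioo x b, w t) ∧ (∫⁻ t in Ioo x b, w t) < ∞)
    {x t : ℝ} (hax : a < x) (hxt : x < t) (htb : t < b) :
    (∫⁻ s in Ioo t b, u s) ^ (1 / q) * Vr r v x t ≤
      C₁ a b r p q u v w * (∫⁻ s in Ioo x b, w s) ^ (1 / p) := by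
  set M := C₁ a b r p q u v w * (∫⁻ s in Ioo x b, w s) ^ (1 / p) with hM
  rcases eq_or_ne M ∞ with hMt | hMt
  · rw [hMt]; exact le_top
  have hU0 : (∫⁻ s in Ioo t b, u s) ^ (1 / q) ≠ 0 :=
    (ENNReal.rpow_pos_of_nonneg (tail_weight_pos hu ⟨hax.trans hxt, htb⟩) (by positivity)).ne'
  rw [mul_comm, ← ENNReal.le_div_iff_mul_le (Or.inl hU0) (Or.inr hMt)]
  set δ : ℕ → ℝ := fun i => (t - x) / (i + 2) with hδ
  have hδ0 : ∀ i, 0 < δ i := fun i => div_pos (by linarith) (by positivity)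
  have hδ2 : ∀ i, 2 * δ i ≤ t - x := fun i => by
    have : (0 : ℝ) ≤ i := by positivity
    rw [hδ, ← mul_div_assoc, div_le_iff₀ (by positivity)]
    nlinarith
  have hδt : Filter.Tendsto δ Filter.atTop (nhds 0) :=
    Filter.Tendsto.div_atTop tendsto_const_nhds
      (Filter.tendsto_atTop_add_const_right _ _ tendsto_natCast_atTop_atTop)
  have hδa : Antitone δ := fun i j hij => by
    have : (i : ℝ) ≤ j := by exact_mod_cast hij
    exact div_le_div_of_nonneg_left (by linarith) (by positivity) (by linarith)
  have hU : Ioo x t = ⋃ i, Ioo (x + δ i) (t - δ i) := by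
    refine Subset.antisymm (fun y hy => ?_) (iUnion_subset fun i =>
      Ioo_subset_Ioo (by linarith [hδ0 i]) (by linarith [hδ0 i]))
    obtain ⟨i, hi⟩ := (hδt.eventually (gt_mem_nhds (lt_min (sub_pos.2 hy.1)
      (sub_pos.2 hy.2)))).exists
    have h1 := lt_min_iff.1 hi
    exact mem_iUnion.2 ⟨i, by linarith [h1.1], by linarith [h1.2]⟩
  rw [Vr_eq_vrOn, hU]
  refine vrOn_iUnion_le_of_monotone hr0 hr1
    (fun i j hij => Ioo_subset_Ioo (by linarith [hδa hij]) (by linarith [hδa hij])) fun i => ?_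
  rw [ENNReal.le_div_iff_mul_le (Or.inl hU0) (Or.inr hMt), mul_comm]
  obtain ⟨x', hx', hx'C⟩ := exists_mem_Ioo_of_ae (a := a) (b := b)
    (show x < x + δ i by linarith [hδ0 i]) hax.le (by linarith [hδ0 i, hδ2 i])
    (_root_.ae_le_essSup (f := fun x => (∫⁻ t in Set.Ioo x b, w t) ^ (-(1 / p)) *
      essSup (fun t => (∫⁻ s in Set.Ioo t b, u s) ^ (1 / q) * Vr r v x t)
        (volume.restrict (Set.Ioo x b))))
  obtain ⟨t', ht', ht'C⟩ := exists_mem_Ioo_of_ae (a := x') (b := b)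
    (show t - δ i < t by linarith [hδ0 i]) (by linarith [hδ2 i, hx'.2]) htb.le
    (_root_.ae_le_essSup (f := fun t => (∫⁻ s in Set.Ioo t b, u s) ^ (1 / q) * Vr r v x' t))
  have hWx' := hw x' ⟨hax.trans hx'.1, by linarith [hδ2 i, hx'.2, hδ0 i]⟩
  calc (∫⁻ s in Ioo t b, u s) ^ (1 / q) * vrOn r v (Ioo (x + δ i) (t - δ i))
      ≤ (∫⁻ s in Ioo t' b, u s) ^ (1 / q) * Vr r v x' t' := by
        rw [Vr_eq_vrOn]
        gcongr ?_ ^ _ * ?_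
        · exact tail_antitone ht'.2.le
        · exact vrOn_mono hr0 hr1 (Ioo_subset_Ioo hx'.2.le ht'.1.le)
    _ ≤ _ := ht'C
    _ ≤ C₁ a b r p q u v w * (∫⁻ s in Ioo x' b, w s) ^ (1 / p) := by
        have h := hx'C
        rw [ENNReal.rpow_neg, mul_comm, ← div_eq_mul_inv, ENNReal.div_le_iff] at h
        · exact h
        · exact (ENNReal.rpow_pos hWx'.1 hWx'.2.ne).ne'
        · exact ENNReal.rpow_ne_top_of_nonneg (by positivity) hWx'.2.ne
    _ ≤ _ := by
        rw [hM]
        exact mul_le_mul_right (ENNReal.rpow_le_rpow (tail_antitone hx'.1.le) (by positivity)) _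

/-- Splitting `(a,b)` along the points where the primitive of `h` equals a power of two. -/
lemma exists_dyadic_intervals {a b : ℝ} {h u : ℝ → ℝ≥0∞} (hh : Measurable h) (hu : Measurable u)
    (hfin : ∫⁻ t in Ioo a b, h t ≠ ∞) {Q : ℝ} (hQ : 0 < Q) :
    ∃ (S : Set ℤ) (σ τ : ℤ → ℝ), (∀ k ∈ S, a < σ k ∧ σ k < τ k ∧ τ k < b) ∧
      (∀ j ∈ S, ∀ k ∈ S, j < k → τ j ≤ σ k) ∧
      ∫⁻ t in Ioo a b, (∫⁻ s in Ioo a t, h s) ^ Q * u t ≤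
        4 ^ Q * ∑' k : S, (∫⁻ s in Ioo (σ k) (τ k), h s) ^ Q * ∫⁻ s in Ioo (τ k) b, u s := by
  have hpt : ∀ k : ℤ, ∃ x : ℝ, (2 : ℝ≥0∞) ^ (k : ℝ) < ∫⁻ t in Ioo a b, h t →
      x ∈ Ioo a b ∧ ∫⁻ t in Ioo a x, h t = 2 ^ (k : ℝ) := fun k => by
    by_cases hk : (2 : ℝ≥0∞) ^ (k : ℝ) < ∫⁻ t in Ioo a b, h t
    · obtain ⟨x, hx⟩ := exists_setLIntegral_Ioo_eq hh hfin
        (pos_iff_ne_zero.2 (two_rpow_ne_zero _)) hk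
      exact ⟨x, fun _ => hx⟩
    · exact ⟨0, fun hk' => absurd hk' hk⟩
  choose τ hτ using hpt
  set S : Set ℤ := {k | (2 : ℝ≥0∞) ^ (k : ℝ) < ∫⁻ t in Ioo a b, h t} with hS
  have hmono : Monotone fun t => ∫⁻ s in Ioo a t, h s :=
    fun _ _ hst => lintegral_mono_set (Ioo_subset_Ioo_right hst)
  have hlt : ∀ j ∈ S, ∀ k ∈ S, j < k → τ j < τ k := fun j hj k hk hjk => by
    by_contra! hle
    have h1 := hmono hle
    simp only [(hτ j hj).2, (hτ k hk).2] at h1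
    exact absurd h1 (not_le.2 (ENNReal.rpow_lt_rpow_of_exponent_lt one_lt_two ofNat_ne_top
      (by exact_mod_cast hjk)))
  have hpred : ∀ k ∈ S, k - 1 ∈ S := fun k hk =>
    lt_of_le_of_lt (two_rpow_mono (by push_cast; linarith)) hk
  have hhalf : ∀ k : ℤ, (2 : ℝ≥0∞) ^ (k : ℝ) =
      2 ^ ((k - 1 : ℤ) : ℝ) + 2 ^ ((k - 1 : ℤ) : ℝ) := fun k => by
    rw [← mul_two]
    conv_lhs => rw [← sub_add_cancel (k : ℝ) 1, two_rpow_add, ENNReal.rpow_one]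
    push_cast; rfl
  have hmass : ∀ k ∈ S, ∫⁻ s in Ioo (τ (k - 1)) (τ k), h s = 2 ^ ((k - 1 : ℤ) : ℝ) :=
    fun k hk => by
    have h1 := hτ k hk
    have h2 := hτ (k - 1) (hpred k hk)
    have h3 := setLIntegral_Ioo_add h h2.1.1 (hlt _ (hpred k hk) k hk (by lia))
    rw [h1.2, h2.2, hhalf k] at h3
    exact ((ENNReal.add_right_inj (two_rpow_ne_top _)).1 h3).symm
  refine ⟨S, fun k => τ (k - 1), τ, fun k hk => ⟨(hτ _ (hpred k hk)).1.1,
    hlt _ (hpred k hk) k hk (by lia), (hτ k hk).1.2⟩, fun j hj k hk hjk => ?_, ?_⟩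
  · rcases (show j ≤ k - 1 by lia).eq_or_lt with h1 | h1
    · rw [h1]
    · exact (hlt j hj _ (hpred k hk) h1).le
  calc ∫⁻ t in Ioo a b, (∫⁻ s in Ioo a t, h s) ^ Q * u t
      ≤ ∫⁻ t in Ioo a b, ∑' k : S, 4 ^ Q * (2 ^ (((k : ℤ) - 1 : ℤ) : ℝ)) ^ Q *
          (Ioo (τ k) b).indicator u t := by
        refine setLIntegral_mono' measurableSet_Ioo fun t ht => ?_
        rcases eq_or_ne (∫⁻ s in Ioo a t, h s) 0 with h0 | h0
        · rw [h0, ENNReal.zero_rpow_of_pos hQ, zero_mul]; exact zero_le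
        have hle : ∫⁻ s in Ioo a t, h s ≤ ∫⁻ s in Ioo a b, h s := hmono ht.2.le
        obtain ⟨k, hk⟩ := ENNReal.exists_mem_Ioc_zpow h0 (ne_top_of_le_ne_top hfin hle)
          one_lt_two ofNat_ne_top
        rw [← ENNReal.rpow_intCast, ← ENNReal.rpow_intCast] at hk
        have hkS : k ∈ S := hk.1.trans_le hle
        refine le_trans ?_ (ENNReal.le_tsum (⟨k, hkS⟩ : S))
        have hτt : τ k < t := by
          by_contra! hc
          have := hmono hc
          simp only [(hτ k hkS).2] at this
          exact absurd hk.1 (not_lt.2 this)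
        rw [indicator_of_mem (show t ∈ Ioo (τ k) b from ⟨hτt, ht.2⟩),
          ← ENNReal.mul_rpow_of_nonneg _ _ hQ.le]
        gcongr
        refine hk.2.trans (le_of_eq ?_)
        have e4 : (4 : ℝ≥0∞) = 2 ^ (2 : ℝ) := by norm_num
        rw [e4, ← two_rpow_add]
        congr 1
        push_cast; ring
    _ = ∑' k : S, 4 ^ Q * (2 ^ (((k : ℤ) - 1 : ℤ) : ℝ)) ^ Q * ∫⁻ s in Ioo (τ k) b, u s := by
        rw [lintegral_tsum fun k =>
          ((hu.indicator measurableSet_Ioo).const_mul _).aemeasurable]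
        congr 1; ext k
        rw [lintegral_const_mul _ (hu.indicator measurableSet_Ioo),
          lintegral_indicator measurableSet_Ioo, Measure.restrict_restrict measurableSet_Ioo,
          Ioo_inter_Ioo, min_self, max_eq_left (hτ k k.2).1.1.le]
    _ = _ := by
        rw [← ENNReal.tsum_mul_left]
        congr 1; ext k
        rw [hmass k k.2, mul_assoc]

section sufficiency

variable {a b r p q : ℝ} {u v w : ℝ → ℝ≥0∞}

lemma tsum_Vr_le (hr0 : 0 < r) (hr1 : r ≤ 1) (hrp : r < p) (hww : IsWeight a b w)
    (hw : ∀ x ∈ Ioo a b, 0 < (∫⁻ t in Ioo x b, w t) ∧ (∫⁻ t in Ioo x b, w t) < ∞)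
    {σ τ : ℝ} (hτb : τ < b) {n₀ : ℤ} (hn₀ : σ ∈ tailLevel a b w n₀) :
    ∑' n : ℤ, (if n₀ + 2 ≤ n then (2 : ℝ≥0∞) ^ (r / (p - r) * n) *
        vrOn r v (Ioo σ τ ∩ tailLevel a b w n) ^ (p * r / (p - r)) else 0) ≤
      2 ^ (p / (p - r)) * ∫⁻ t in Ioo a τ, (∫⁻ s in Ioo t b, w s) ^ (-(p / (p - r))) * w t *
        Vr r v t τ ^ (p * r / (p - r)) := by
  have hpr : 0 < p - r := sub_pos.2 hrp
  have hp : 0 < p := hr0.trans hrp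
  have hexp : 0 < p * r / (p - r) := by positivity
  set Φ : ℝ → ℝ≥0∞ := fun t => (∫⁻ s in Ioo t b, w s) ^ (-(p / (p - r))) * w t *
        Vr r v t τ ^ (p * r / (p - r)) with hΦ
  rw [setLIntegral_eq_tsum_tailLevel hw measurableSet_Ioo (Ioo_subset_Ioo_right hτb.le) Φ,
    ← (Equiv.subRight (1 : ℤ)).tsum_eq (fun n => ∫⁻ t in Ioo a τ ∩ tailLevel a b w n, Φ t),
    ← ENNReal.tsum_mul_left]
  refine ENNReal.tsum_le_tsum fun n => ?_
  split_ifs with hn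
  swap
  · exact zero_le
  rcases (Ioo σ τ ∩ tailLevel a b w n).eq_empty_or_nonempty with he | ⟨y, hy⟩
  · rw [he, vrOn_empty hr0 hr1, ENNReal.zero_rpow_of_pos hexp, mul_zero]; exact zero_le
  simp only [Equiv.subRight_apply]
  have hsub : tailLevel a b w (n - 1) ⊆ Ioo a τ := fun t ht =>
    ⟨ht.1.1, (lt_of_mem_tailLevel (by lia) ht hy.2).trans hy.1.2⟩
  rw [inter_eq_right.2 hsub]
  have hσb : σ ∈ Ioo a b := hn₀.1
  have hnr : (n₀ : ℝ) + 2 ≤ n := by exact_mod_cast hn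
  have hmass := le_setLIntegral_tailLevel hww hw (m := n - 1) hσb
    (lt_of_le_of_lt (two_rpow_mono (by push_cast; linarith)) hn₀.2.1)
  set V := vrOn r v (Ioo σ τ ∩ tailLevel a b w n) with hV
  calc (2 : ℝ≥0∞) ^ (r / (p - r) * n) * V ^ (p * r / (p - r))
      = 2 ^ (p / (p - r)) * ((2 ^ (((n - 1 : ℤ) : ℝ) * (p / (p - r))) * V ^ (p * r / (p - r))) *
          2 ^ (-((n - 1 : ℤ) : ℝ) - 1)) := by
        rw [mul_right_comm, ← mul_assoc, ← two_rpow_add, ← two_rpow_add]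
        congr 2
        push_cast; field_simp; ring
    _ ≤ 2 ^ (p / (p - r)) * ((2 ^ (((n - 1 : ℤ) : ℝ) * (p / (p - r))) * V ^ (p * r / (p - r))) *
          ∫⁻ t in tailLevel a b w (n - 1), w t) := by gcongr
    _ = 2 ^ (p / (p - r)) * ∫⁻ t in tailLevel a b w (n - 1),
          (2 ^ (((n - 1 : ℤ) : ℝ) * (p / (p - r))) * V ^ (p * r / (p - r))) * w t := by
        rw [lintegral_const_mul _ hww.1]
    _ ≤ _ := by
        refine mul_le_mul_right (setLIntegral_mono' (measurableSet_tailLevel _) fun t ht => ?_) _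
        rw [hΦ, mul_right_comm]
        have h1 : (2 : ℝ≥0∞) ^ (((n - 1 : ℤ) : ℝ) * (p / (p - r))) ≤
            (∫⁻ s in Ioo t b, w s) ^ (-(p / (p - r))) := by
          have h2 := ENNReal.rpow_le_rpow (z := p / (p - r))
            (ENNReal.inv_le_inv.2 ht.2.2) (by positivity)
          rw [← ENNReal.rpow_neg, neg_neg, ← ENNReal.rpow_mul] at h2
          rwa [ENNReal.rpow_neg, ← ENNReal.inv_rpow]
        have h3 : V ≤ Vr r v t τ := by
          rw [Vr_eq_vrOn]
          exact vrOn_mono hr0 hr1 fun s hs => ⟨lt_of_mem_tailLevel (by lia) ht hs.2, hs.1.2⟩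
        exact mul_le_mul' (mul_le_mul_left h1 _) (ENNReal.rpow_le_rpow h3 hexp.le)

lemma local_estimate (hr0 : 0 < r) (hr1 : r ≤ 1) (hrp : r < p) (hpq : p ≤ q)
    (hv : Measurable v) (hww : IsWeight a b w)
    (hw : ∀ x ∈ Ioo a b, 0 < (∫⁻ t in Ioo x b, w t) ∧ (∫⁻ t in Ioo x b, w t) < ∞)
    {A B : ℝ≥0∞}
    (hA : ∀ x t, a < x → x < t → t < b → (∫⁻ s in Ioo t b, u s) ^ (1 / q) * Vr r v x t ≤
      A * (∫⁻ s in Ioo x b, w s) ^ (1 / p))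
    (hB : ∀ x ∈ Ioo a b, (∫⁻ t in Ioo x b, u t) ^ (1 / q) *
      (∫⁻ t in Ioo a x, (∫⁻ s in Ioo t b, w s) ^ (-(p / (p - r))) * w t *
        Vr r v t x ^ (p * r / (p - r))) ^ ((p - r) / (p * r)) ≤ B)
    {f : ℝ → ℝ≥0∞} (hf : Measurable f)
    {σ τ : ℝ} (haσ : a < σ) (hστ : σ < τ) (hτb : τ < b) {n₀ : ℤ} (hn₀ : σ ∈ tailLevel a b w n₀) :
    (∫⁻ s in Ioo σ τ, f s ^ r * v s) ^ (q / r) * ∫⁻ s in Ioo τ b, u s ≤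
      3 ^ (q / r) * (2 * (2 ^ (q / p) * A ^ q) *
        (∑' n : ℤ, 2 ^ (-(n : ℝ) * (q / p)) * (∫⁻ s in Ioo σ τ ∩ tailLevel a b w n, f s) ^ q) +
        2 ^ (q / r) * B ^ q * (∑' n : ℤ, if n₀ + 2 ≤ n then 2 ^ (-(n : ℝ)) *
          (∫⁻ s in Ioo σ τ ∩ tailLevel a b w n, f s) ^ p else 0) ^ (q / p)) := by
  have hp : 0 < p := hr0.trans hrp
  have hq : 0 < q := hp.trans_le hpq
  have hpr : 0 < p - r := sub_pos.2 hrp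
  set U := ∫⁻ s in Ioo τ b, u s with hU
  set β : ℤ → ℝ≥0∞ := fun n => ∫⁻ s in Ioo σ τ ∩ tailLevel a b w n, f s with hβ
  set V : ℤ → ℝ≥0∞ := fun n => vrOn r v (Ioo σ τ ∩ tailLevel a b w n) with hV
  set X : ℤ → ℝ≥0∞ := fun n => β n ^ r * V n ^ r with hX
  set R : ℝ≥0∞ := ∑' n : ℤ, if n₀ + 2 ≤ n then X n else 0 with hR
  have hsum : ∫⁻ s in Ioo σ τ, f s ^ r * v s ≤ X n₀ + X (n₀ + 1) + R := by
    rw [setLIntegral_eq_tsum_tailLevel hw measurableSet_Ioo (Ioo_subset_Ioo haσ.le hτb.le)]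
    calc ∑' n, ∫⁻ s in Ioo σ τ ∩ tailLevel a b w n, f s ^ r * v s
        ≤ ∑' n : ℤ, ((if n = n₀ then X n else 0) + (if n = n₀ + 1 then X n else 0) +
            if n₀ + 2 ≤ n then X n else 0) := by
          refine ENNReal.tsum_le_tsum fun n => ?_
          have h1 : ∫⁻ s in Ioo σ τ ∩ tailLevel a b w n, f s ^ r * v s ≤ X n :=
            setLIntegral_rpow_mul_le hr0 hr1 hv hf _
          rcases lt_trichotomy n n₀ with h | h | h
          · have : Ioo σ τ ∩ tailLevel a b w n = ∅ := by
              refine eq_empty_of_forall_notMem fun t ht => ?_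
              exact (lt_of_mem_tailLevel h ht.2 hn₀).not_ge ht.1.1.le
            rw [this]; simp
          · refine h1.trans ?_
            rw [if_pos h]
            exact le_add_right le_self_add
          · rcases (show n₀ + 1 ≤ n by lia).eq_or_lt with h' | h'
            · refine h1.trans ?_
              rw [if_pos h'.symm]
              exact le_add_right le_add_self
            · refine h1.trans ?_
              rw [if_pos (show n₀ + 2 ≤ n by lia)]
              exact le_add_self
      _ = _ := by
          rw [ENNReal.tsum_add, ENNReal.tsum_add, tsum_ite_eq, tsum_ite_eq]
  have hXU : ∀ m : ℤ, n₀ ≤ m → m ≤ n₀ + 1 → X m ^ (q / r) * U ≤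
      2 ^ (q / p) * A ^ q * ∑' n : ℤ, 2 ^ (-(n : ℝ) * (q / p)) * β n ^ q := by
    intro m hm0 hm
    have hm' : (m : ℝ) ≤ n₀ + 1 := by exact_mod_cast hm
    have h1 : U ^ (1 / q) * V m ≤ A * (2 ^ (-(n₀ : ℝ))) ^ (1 / p) := by
      calc U ^ (1 / q) * V m ≤ U ^ (1 / q) * Vr r v σ τ := by
            gcongr
            exact vrOn_mono hr0 hr1 inter_subset_left
        _ ≤ _ := hA σ τ haσ hστ hτb
        _ ≤ _ := mul_le_mul_right (ENNReal.rpow_le_rpow hn₀.2.2 (by positivity)) _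
    have h2 := ENNReal.rpow_le_rpow h1 hq.le
    rw [ENNReal.mul_rpow_of_nonneg _ _ hq.le, ENNReal.mul_rpow_of_nonneg _ _ hq.le,
      ← ENNReal.rpow_mul, ← ENNReal.rpow_mul, ← ENNReal.rpow_mul,
      one_div_mul_cancel hq.ne', ENNReal.rpow_one] at h2
    calc X m ^ (q / r) * U = β m ^ q * (U * V m ^ q) := by
          rw [hX]
          simp only
          rw [ENNReal.mul_rpow_of_nonneg _ _ (by positivity), ← ENNReal.rpow_mul,
            ← ENNReal.rpow_mul, mul_div_cancel₀ _ hr0.ne']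
          ring
      _ ≤ β m ^ q * (A ^ q * 2 ^ (-(n₀ : ℝ) * (1 / p * q))) := by
          gcongr
      _ ≤ β m ^ q * (A ^ q * (2 ^ (q / p) * 2 ^ (-(m : ℝ) * (q / p)))) := by
          rw [← two_rpow_add]
          gcongr
          · exact one_le_two
          · have : 0 < q / p := by positivity
            have e : 1 / p * q = q / p := by ring
            rw [e]
            nlinarith
      _ = 2 ^ (q / p) * A ^ q * (2 ^ (-(m : ℝ) * (q / p)) * β m ^ q) := by ring
      _ ≤ _ := by
          gcongr
          exact ENNReal.le_tsum (f := fun n : ℤ => 2 ^ (-(n : ℝ) * (q / p)) * β n ^ q) m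
  set S : ℝ≥0∞ := ∑' n : ℤ, if n₀ + 2 ≤ n then 2 ^ (-(n : ℝ)) * β n ^ p else 0 with hS
  have hRU : R ^ (q / r) * U ≤ 2 ^ (q / r) * B ^ q * S ^ (q / p) := by
    set Φ := ∫⁻ t in Ioo a τ, (∫⁻ s in Ioo t b, w s) ^ (-(p / (p - r))) * w t *
        Vr r v t τ ^ (p * r / (p - r)) with hΦ
    have hc : (p / r).HolderConjugate (p / (p - r)) := by
      rw [Real.holderConjugate_iff]
      refine ⟨by rw [lt_div_iff₀ hr0]; linarith, by field_simp; ring⟩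
    have h1 : R ≤ S ^ (r / p) * (2 ^ (p / (p - r)) * Φ) ^ ((p - r) / p) := by
      have h2 := tsum_mul_le_Lp_mul_Lq
        (fun n : ℤ => if n₀ + 2 ≤ n then (2 : ℝ≥0∞) ^ (-(n : ℝ) * (r / p)) * β n ^ r else 0)
        (fun n : ℤ => if n₀ + 2 ≤ n then (2 : ℝ≥0∞) ^ ((n : ℝ) * (r / p)) * V n ^ r else 0) hc
      have e1 : ∀ n : ℤ, (if n₀ + 2 ≤ n then (2 : ℝ≥0∞) ^ (-(n : ℝ) * (r / p)) * β n ^ r else 0) *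
          (if n₀ + 2 ≤ n then (2 : ℝ≥0∞) ^ ((n : ℝ) * (r / p)) * V n ^ r else 0) =
          if n₀ + 2 ≤ n then X n else 0 := fun n => by
        split_ifs
        · rw [mul_mul_mul_comm, ← two_rpow_add]
          simp [hX]
        · simp
      have e2 : ∀ n : ℤ, (if n₀ + 2 ≤ n then (2 : ℝ≥0∞) ^ (-(n : ℝ) * (r / p)) * β n ^ r
          else 0) ^ (p / r) = if n₀ + 2 ≤ n then 2 ^ (-(n : ℝ)) * β n ^ p else 0 := fun n => by
        split_ifs
        · rw [ENNReal.mul_rpow_of_nonneg _ _ (by positivity), ← ENNReal.rpow_mul,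
            ← ENNReal.rpow_mul]
          congr 2 <;> field_simp
        · exact ENNReal.zero_rpow_of_pos (by positivity)
      have e3 : ∀ n : ℤ, (if n₀ + 2 ≤ n then (2 : ℝ≥0∞) ^ ((n : ℝ) * (r / p)) * V n ^ r
          else 0) ^ (p / (p - r)) = if n₀ + 2 ≤ n then (2 : ℝ≥0∞) ^ (r / (p - r) * n) *
            V n ^ (p * r / (p - r)) else 0 := fun n => by
        split_ifs
        · rw [ENNReal.mul_rpow_of_nonneg _ _ (by positivity), ← ENNReal.rpow_mul,
            ← ENNReal.rpow_mul]
          congr 2 <;> field_simp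
        · exact ENNReal.zero_rpow_of_pos (by positivity)
      simp only [e1, e2, e3, one_div_div] at h2
      refine h2.trans ?_
      gcongr
      exact tsum_Vr_le hr0 hr1 hrp hww hw hτb hn₀
    have h3 := ENNReal.rpow_le_rpow (hB τ ⟨haσ.trans hστ, hτb⟩) hq.le
    rw [ENNReal.mul_rpow_of_nonneg _ _ hq.le, ← ENNReal.rpow_mul, ← ENNReal.rpow_mul,
      one_div_mul_cancel hq.ne', ENNReal.rpow_one] at h3
    calc R ^ (q / r) * U
        ≤ (S ^ (r / p) * (2 ^ (p / (p - r)) * Φ) ^ ((p - r) / p)) ^ (q / r) * U := by gcongr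
      _ = 2 ^ (q / r) * (U * Φ ^ ((p - r) / (p * r) * q)) * S ^ (q / p) := by
          rw [ENNReal.mul_rpow_of_nonneg _ _ (by positivity), ← ENNReal.rpow_mul,
            ← ENNReal.rpow_mul, ENNReal.mul_rpow_of_nonneg _ _ (by positivity),
            ← ENNReal.rpow_mul]
          have e1 : r / p * (q / r) = q / p := by field_simp
          have e2 : p / (p - r) * ((p - r) / p * (q / r)) = q / r := by field_simp
          have e3 : (p - r) / p * (q / r) = (p - r) / (p * r) * q := by field_simp
          rw [e1, e2, e3]
          ring
      _ ≤ _ := by gcongr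
  calc (∫⁻ s in Ioo σ τ, f s ^ r * v s) ^ (q / r) * U
      ≤ (X n₀ + X (n₀ + 1) + R) ^ (q / r) * U := by gcongr
    _ ≤ 3 ^ (q / r) * (X n₀ ^ (q / r) + X (n₀ + 1) ^ (q / r) + R ^ (q / r)) * U := by
        gcongr
        exact add_add_rpow_le _ _ _ (by positivity)
    _ = 3 ^ (q / r) * (X n₀ ^ (q / r) * U + X (n₀ + 1) ^ (q / r) * U + R ^ (q / r) * U) := by
        ring
    _ ≤ 3 ^ (q / r) * (2 ^ (q / p) * A ^ q * (∑' n : ℤ, 2 ^ (-(n : ℝ) * (q / p)) * β n ^ q) +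
          2 ^ (q / p) * A ^ q * (∑' n : ℤ, 2 ^ (-(n : ℝ) * (q / p)) * β n ^ q) +
          2 ^ (q / r) * B ^ q * S ^ (q / p)) := by
        exact mul_le_mul_right (add_le_add (add_le_add (hXU n₀ le_rfl (by lia))
          (hXU (n₀ + 1) (by lia) le_rfl)) hRU) _
    _ = _ := by ring

lemma tsum_tailLevel_le (hp : 0 < p) (hww : IsWeight a b w)
    (hw : ∀ x ∈ Ioo a b, 0 < (∫⁻ t in Ioo x b, w t) ∧ (∫⁻ t in Ioo x b, w t) < ∞)
    (f : ℝ → ℝ≥0∞) :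
    ∑' n : ℤ, (2 : ℝ≥0∞) ^ (-(n : ℝ)) * (∫⁻ s in tailLevel a b w n, f s) ^ p ≤
      4 * ∫⁻ t in Ioo a b, (∫⁻ s in Ioo a t, f s) ^ p * w t := by
  set Φ : ℝ → ℝ≥0∞ := fun t => (∫⁻ s in Ioo a t, f s) ^ p * w t with hΦ
  rw [setLIntegral_eq_tsum_tailLevel hw measurableSet_Ioo subset_rfl Φ,
    ← (Equiv.addRight (1 : ℤ)).tsum_eq (fun n => ∫⁻ t in Ioo a b ∩ tailLevel a b w n, Φ t),
    ← ENNReal.tsum_mul_left]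
  refine ENNReal.tsum_le_tsum fun n => ?_
  rcases (tailLevel a b w n).eq_empty_or_nonempty with he | ⟨y, hy⟩
  · rw [he]; simp [hp]
  simp only [Equiv.coe_addRight]
  rw [inter_eq_right.2 (tailLevel_subset _)]
  have hmass := le_setLIntegral_tailLevel hww hw (m := n + 1) hy.1
    (lt_of_le_of_lt (two_rpow_mono (by push_cast; linarith)) hy.2.1)
  set c := ∫⁻ s in tailLevel a b w n, f s
  calc (2 : ℝ≥0∞) ^ (-(n : ℝ)) * c ^ p = 4 * (c ^ p * 2 ^ (-((n + 1 : ℤ) : ℝ) - 1)) := by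
        have e4 : (4 : ℝ≥0∞) = 2 ^ (2 : ℝ) := by norm_num
        rw [mul_left_comm, e4, ← two_rpow_add, mul_comm]
        congr 2
        push_cast; ring
    _ ≤ 4 * (c ^ p * ∫⁻ t in tailLevel a b w (n + 1), w t) := by gcongr
    _ = 4 * ∫⁻ t in tailLevel a b w (n + 1), c ^ p * w t := by rw [lintegral_const_mul _ hww.1]
    _ ≤ _ := by
        refine mul_le_mul_right (setLIntegral_mono' (measurableSet_tailLevel _) fun t ht => ?_) _
        have hsub : tailLevel a b w n ⊆ Ioo a t := fun s hs =>
          ⟨hs.1.1, lt_of_mem_tailLevel (by lia) hs ht⟩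
        exact mul_le_mul_left (ENNReal.rpow_le_rpow (lintegral_mono_set hsub) hp.le) _

lemma lintegral_rpow_mul_le_of_ne_top (hr0 : 0 < r) (hr1 : r ≤ 1) (hrp : r < p) (hpq : p ≤ q)
    (hq1 : 1 ≤ q) (hum : Measurable u) (hv : Measurable v) (hww : IsWeight a b w)
    (hw : ∀ x ∈ Ioo a b, 0 < (∫⁻ t in Ioo x b, w t) ∧ (∫⁻ t in Ioo x b, w t) < ∞)
    {A B : ℝ≥0∞}
    (hA : ∀ x t, a < x → x < t → t < b → (∫⁻ s in Ioo t b, u s) ^ (1 / q) * Vr r v x t ≤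
      A * (∫⁻ s in Ioo x b, w s) ^ (1 / p))
    (hB : ∀ x ∈ Ioo a b, (∫⁻ t in Ioo x b, u t) ^ (1 / q) *
      (∫⁻ t in Ioo a x, (∫⁻ s in Ioo t b, w s) ^ (-(p / (p - r))) * w t *
        Vr r v t x ^ (p * r / (p - r))) ^ ((p - r) / (p * r)) ≤ B)
    {f : ℝ → ℝ≥0∞} (hf : Measurable f) (hfin : ∫⁻ t in Ioo a b, f t ^ r * v t ≠ ∞) :
    ∫⁻ t in Ioo a b, (∫⁻ s in Ioo a t, f s ^ r * v s) ^ (q / r) * u t ≤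
      4 ^ (q / r) * (3 ^ (q / r) * (2 * (2 ^ (q / p) * A ^ q) + 2 ^ (q / r) * B ^ q)) *
        (4 * ∫⁻ t in Ioo a b, (∫⁻ s in Ioo a t, f s) ^ p * w t) ^ (q / p) := by
  have hp : 0 < p := hr0.trans hrp
  have hq : 0 < q := hp.trans_le hpq
  have hqp : 1 ≤ q / p := (one_le_div hp).2 hpq
  obtain ⟨S, σ, τ, hS, hSτ, hle⟩ := exists_dyadic_intervals (a := a) (b := b)
    ((hf.pow_const r).mul hv) hum hfin (Q := q / r) (by positivity)
  have hlev : ∀ k : S, ∃ n, σ k ∈ tailLevel a b w n := fun k =>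
    have hk := hS k k.2
    have hσ : σ k ∈ Ioo a b := ⟨hk.1, hk.2.1.trans hk.2.2⟩
    exists_mem_tailLevel hσ (hw _ hσ).1 (hw _ hσ).2
  choose n₀ hn₀ using hlev
  set α : ℤ → ℝ≥0∞ := fun n => ∫⁻ s in tailLevel a b w n, f s with hα
  set β : S → ℤ → ℝ≥0∞ :=
    fun k n => ∫⁻ s in Ioo (σ k) (τ k) ∩ tailLevel a b w n, f s with hβ
  set M : ℝ≥0∞ := ∑' n : ℤ, (2 : ℝ≥0∞) ^ (-(n : ℝ)) * α n ^ p with hM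
  have hβα : ∀ n, ∑' k, β k n ≤ α n := fun n => by
    simp only [hβ]
    rw [← lintegral_iUnion (fun k => measurableSet_Ioo.inter (measurableSet_tailLevel n))]
    · exact lintegral_mono_set (iUnion_subset fun k => inter_subset_right)
    · intro j k hjk
      refine Set.disjoint_left.2 fun t hj hk => ?_
      rcases (Subtype.coe_ne_coe.2 hjk).lt_or_gt with h | h
      · exact (hj.1.2.trans_le (hSτ j j.2 k k.2 h)).not_gt hk.1.1
      · exact (hk.1.2.trans_le (hSτ k k.2 j j.2 h)).not_gt hj.1.1
  have hT : ∑' k : S, ∑' n : ℤ, (2 : ℝ≥0∞) ^ (-(n : ℝ) * (q / p)) * β k n ^ q ≤ M ^ (q / p) := by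
    rw [ENNReal.tsum_comm]
    calc ∑' n : ℤ, ∑' k : S, (2 : ℝ≥0∞) ^ (-(n : ℝ) * (q / p)) * β k n ^ q
        ≤ ∑' n : ℤ, ((2 : ℝ≥0∞) ^ (-(n : ℝ)) * α n ^ p) ^ (q / p) := by
          refine ENNReal.tsum_le_tsum fun n => ?_
          rw [ENNReal.tsum_mul_left, ENNReal.mul_rpow_of_nonneg _ _ (by positivity),
            ← ENNReal.rpow_mul, ← ENNReal.rpow_mul, mul_div_cancel₀ _ hp.ne']
          exact mul_le_mul_right ((tsum_rpow_le_rpow_tsum _ hq1).trans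
            (ENNReal.rpow_le_rpow (hβα n) hq.le)) _
      _ ≤ _ := tsum_rpow_le_rpow_tsum _ hqp
  have hR : ∑' k : S, (∑' n : ℤ, if n₀ k + 2 ≤ n then (2 : ℝ≥0∞) ^ (-(n : ℝ)) * β k n ^ p
      else 0) ^ (q / p) ≤ M ^ (q / p) := by
    refine (tsum_rpow_le_rpow_tsum _ hqp).trans (ENNReal.rpow_le_rpow ?_ (by positivity))
    rw [ENNReal.tsum_comm]
    refine ENNReal.tsum_le_tsum fun n => ?_
    by_cases hex : ∃ k : S, n₀ k + 2 ≤ n ∧ β k n ≠ 0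
    swap
    · refine (ENNReal.tsum_eq_zero.2 fun k => ?_).trans_le zero_le
      split_ifs with hk
      · have : β k n = 0 := by
          by_contra h0
          exact hex ⟨k, hk, h0⟩
        rw [this, ENNReal.zero_rpow_of_pos hp, mul_zero]
      · rfl
    obtain ⟨k, hk, hk0⟩ := hex
    have hord : ∀ i j : S, (i : ℤ) < j → β i n ≠ 0 → ¬ n₀ j + 2 ≤ n := fun i j hij hi hj => by
      have hne : (Ioo (σ i) (τ i) ∩ tailLevel a b w n).Nonempty := by
        by_contra he
        rw [not_nonempty_iff_eq_empty] at he
        exact hi (by simp [hβ, he])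
      obtain ⟨t, ht⟩ := hne
      exact (ht.1.2.trans_le (hSτ i i.2 j j.2 hij)).not_gt
        (lt_of_mem_tailLevel (by lia) (hn₀ j) ht.2)
    rw [tsum_eq_single k fun j hj => ?_, if_pos hk]
    · exact mul_le_mul_right (ENNReal.rpow_le_rpow ((ENNReal.le_tsum k).trans (hβα n)) hp.le) _
    · split_ifs with hjn
      · have : β j n = 0 := by
          by_contra h0
          rcases (Subtype.coe_ne_coe.2 hj).lt_or_gt with h | h
          · exact hord j k h h0 hk
          · exact hord k j h hk0 hjn
        rw [this, ENNReal.zero_rpow_of_pos hp, mul_zero]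
      · rfl
  set A' : ℝ≥0∞ := 2 * (2 ^ (q / p) * A ^ q)
  set B' : ℝ≥0∞ := 2 ^ (q / r) * B ^ q
  calc ∫⁻ t in Ioo a b, (∫⁻ s in Ioo a t, f s ^ r * v s) ^ (q / r) * u t
      ≤ 4 ^ (q / r) * ∑' k : S, (∫⁻ s in Ioo (σ k) (τ k), f s ^ r * v s) ^ (q / r) *
          ∫⁻ s in Ioo (τ k) b, u s := hle
    _ ≤ 4 ^ (q / r) * ∑' k : S, 3 ^ (q / r) * (A' *
          (∑' n : ℤ, (2 : ℝ≥0∞) ^ (-(n : ℝ) * (q / p)) * β k n ^ q) +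
          B' * (∑' n : ℤ, if n₀ k + 2 ≤ n then (2 : ℝ≥0∞) ^ (-(n : ℝ)) * β k n ^ p
            else 0) ^ (q / p)) :=
        mul_le_mul_right (ENNReal.tsum_le_tsum fun k : S => local_estimate hr0 hr1 hrp hpq hv hww hw
          hA hB hf (hS k k.2).1 (hS k k.2).2.1 (hS k k.2).2.2 (hn₀ k)) _
    _ = 4 ^ (q / r) * (3 ^ (q / r) * (A' *
          (∑' k : S, ∑' n : ℤ, (2 : ℝ≥0∞) ^ (-(n : ℝ) * (q / p)) * β k n ^ q) +
          B' * ∑' k : S, (∑' n : ℤ, if n₀ k + 2 ≤ n then (2 : ℝ≥0∞) ^ (-(n : ℝ)) * β k n ^ p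
            else 0) ^ (q / p))) := by
        rw [ENNReal.tsum_mul_left, ENNReal.tsum_add, ENNReal.tsum_mul_left, ENNReal.tsum_mul_left]
    _ ≤ 4 ^ (q / r) * (3 ^ (q / r) * (A' * M ^ (q / p) + B' * M ^ (q / p))) := by gcongr
    _ = 4 ^ (q / r) * (3 ^ (q / r) * (A' + B')) * M ^ (q / p) := by ring
    _ ≤ _ := by
        gcongr
        exact tsum_tailLevel_le hp hww hw f

lemma lintegral_rpow_mul_le (hr0 : 0 < r) (hr1 : r ≤ 1) (hrp : r < p) (hpq : p ≤ q)
    (hq1 : 1 ≤ q) (hum : Measurable u) (hv : IsWeight a b v) (hww : IsWeight a b w)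
    (hw : ∀ x ∈ Ioo a b, 0 < (∫⁻ t in Ioo x b, w t) ∧ (∫⁻ t in Ioo x b, w t) < ∞)
    {A B : ℝ≥0∞}
    (hA : ∀ x t, a < x → x < t → t < b → (∫⁻ s in Ioo t b, u s) ^ (1 / q) * Vr r v x t ≤
      A * (∫⁻ s in Ioo x b, w s) ^ (1 / p))
    (hB : ∀ x ∈ Ioo a b, (∫⁻ t in Ioo x b, u t) ^ (1 / q) *
      (∫⁻ t in Ioo a x, (∫⁻ s in Ioo t b, w s) ^ (-(p / (p - r))) * w t *
        Vr r v t x ^ (p * r / (p - r))) ^ ((p - r) / (p * r)) ≤ B)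
    {f : ℝ → ℝ≥0∞} (hf : Measurable f) :
    ∫⁻ t in Ioo a b, (∫⁻ s in Ioo a t, f s ^ r * v s) ^ (q / r) * u t ≤
      4 ^ (q / r) * (3 ^ (q / r) * (2 * (2 ^ (q / p) * A ^ q) + 2 ^ (q / r) * B ^ q)) *
        (4 * ∫⁻ t in Ioo a b, (∫⁻ s in Ioo a t, f s) ^ p * w t) ^ (q / p) := by
  have hp : 0 < p := hr0.trans hrp
  have hq : 0 < q := hp.trans_le hpq
  set g : ℕ → ℝ → ℝ≥0∞ := fun i => {s | v s ≤ i}.indicator fun s => min (f s) i with hg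
  have hgm : ∀ i, Measurable (g i) := fun i =>
    (hf.min measurable_const).indicator (measurableSet_le hv.1 measurable_const)
  have hgf : ∀ i s, g i s ≤ f s := fun i s =>
    indicator_le' (fun _ _ => min_le_left _ _) (fun _ _ => zero_le) s
  have hgmono : Monotone g := fun i j hij s => by
    have hij' : (i : ℝ≥0∞) ≤ j := by exact_mod_cast hij
    simp only [hg]
    by_cases h : v s ≤ i
    · rw [indicator_of_mem (show s ∈ {s | v s ≤ i} from h),
        indicator_of_mem (show s ∈ {s | v s ≤ j} from h.trans hij')]
      gcongr
    · rw [indicator_of_notMem (show s ∉ {s | v s ≤ i} from h)]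
      exact zero_le
  have hsup : ∀ s ∈ Ioo a b, ⨆ i, g i s ^ r * v s = f s ^ r * v s := fun s hs => by
    refine le_antisymm (iSup_le fun i => by gcongr; exact hgf i s) ?_
    rw [← ENNReal.iSup_mul]
    gcongr
    have hfs : f s ≤ ⨆ i, g i s := by
      obtain ⟨m, hm⟩ := ENNReal.exists_nat_gt (hv.2 s hs).2.ne
      refine le_of_forall_lt fun c hc => ?_
      obtain ⟨k, hk⟩ := ENNReal.exists_nat_gt hc.ne_top
      refine lt_of_lt_of_le ?_ (le_iSup _ (max m k))
      have hmem : s ∈ {s | v s ≤ ((max m k : ℕ) : ℝ≥0∞)} :=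
        hm.le.trans (by exact_mod_cast le_max_left m k)
      simp only [hg]
      rw [indicator_of_mem hmem]
      exact lt_min hc (hk.trans_le (by exact_mod_cast le_max_right m k))
    refine (ENNReal.rpow_le_rpow hfs hr0.le).trans (le_of_eq ?_)
    exact (ENNReal.orderIsoRpow r hr0).map_iSup _
  have hinner : ∀ t ∈ Ioo a b, ∫⁻ s in Ioo a t, f s ^ r * v s =
      ⨆ i, ∫⁻ s in Ioo a t, g i s ^ r * v s := fun t ht => by
    rw [← lintegral_iSup (f := fun i s => g i s ^ r * v s)
      (fun i => ((hgm i).pow_const r).mul hv.1) fun i j hij s =>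
        mul_le_mul_left (ENNReal.rpow_le_rpow (hgmono hij s) hr0.le) _]
    exact setLIntegral_congr_fun measurableSet_Ioo fun s hs =>
      (hsup s ⟨hs.1, hs.2.trans ht.2⟩).symm
  have hFm : ∀ i, Measurable fun t => (∫⁻ s in Ioo a t, g i s ^ r * v s) ^ (q / r) * u t :=
    fun i => (Measurable.pow_const (Monotone.measurable fun _ _ hst =>
      lintegral_mono_set (Ioo_subset_Ioo_right hst)) _).mul hum
  have houter : ∫⁻ t in Ioo a b, (∫⁻ s in Ioo a t, f s ^ r * v s) ^ (q / r) * u t =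
      ⨆ i, ∫⁻ t in Ioo a b, (∫⁻ s in Ioo a t, g i s ^ r * v s) ^ (q / r) * u t := by
    rw [← lintegral_iSup hFm fun i j hij t => by
      gcongr with s
      exact hgmono hij s]
    refine setLIntegral_congr_fun measurableSet_Ioo fun t ht => ?_
    rw [hinner t ht, ← ENNReal.iSup_mul]
    congr 1
    exact (ENNReal.orderIsoRpow (q / r) (by positivity)).map_iSup _
  rw [houter]
  refine iSup_le fun i => ?_
  refine (lintegral_rpow_mul_le_of_ne_top hr0 hr1 hrp hpq hq1 hum hv.1 hww hw hA hB (hgm i)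
    ?_).trans ?_
  · refine ne_top_of_le_ne_top (b := (i : ℝ≥0∞) ^ r * i * volume (Ioo a b)) ?_ ?_
    · rw [Real.volume_Ioo]
      exact ENNReal.mul_ne_top (ENNReal.mul_ne_top
        (ENNReal.rpow_ne_top_of_nonneg hr0.le (ENNReal.natCast_ne_top i))
        (ENNReal.natCast_ne_top i)) ENNReal.ofReal_ne_top
    · rw [← setLIntegral_const]
      refine lintegral_mono fun s => ?_
      by_cases h : v s ≤ i
      · simp only [hg]
        rw [indicator_of_mem (show s ∈ {s | v s ≤ i} from h)]
        gcongr
        exact min_le_right _ _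
      · simp only [hg]
        rw [indicator_of_notMem (show s ∉ {s | v s ≤ i} from h), ENNReal.zero_rpow_of_pos hr0,
          zero_mul]
        exact zero_le
  · gcongr
    exact hgf i _

end sufficiency

lemma exists_cesCesIneq {p q r : ℝ} (hr0 : 0 < r) (hrp : r < p) (hpq : p ≤ q)
    (hr1 : r ≤ 1) (hq1 : 1 ≤ q) :
    ∃ κ : ℝ≥0∞, κ < ∞ ∧ ∀ (a b : ℝ) (u v w : ℝ → ℝ≥0∞),
      IsWeight a b u → IsWeight a b v → IsWeight a b w →
      (∀ x ∈ Ioo a b, 0 < (∫⁻ t in Ioo x b, w t) ∧ (∫⁻ t in Ioo x b, w t) < ∞) →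
      CesCesIneq a b r p q u v w (κ * (C₁ a b r p q u v w + C₃ a b r p q u v w)) := by
  have hp : 0 < p := hr0.trans hrp
  have hq : 0 < q := hp.trans_le hpq
  set L : ℝ≥0∞ := 4 ^ (q / r) * (3 ^ (q / r) * (2 * 2 ^ (q / p) + 2 ^ (q / r))) * 4 ^ (q / p)
    with hL
  refine ⟨L ^ (1 / q), ?_, fun a b u v w hu hv hw hww f hf => ?_⟩
  · refine ENNReal.rpow_lt_top_of_nonneg (by positivity) (ne_of_lt ?_)
    have h4 : (4 : ℝ≥0∞) ^ (q / r) < ∞ := ENNReal.rpow_lt_top_of_nonneg (by positivity) ofNat_ne_top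
    have h3 : (3 : ℝ≥0∞) ^ (q / r) < ∞ := ENNReal.rpow_lt_top_of_nonneg (by positivity) ofNat_ne_top
    have h4' : (4 : ℝ≥0∞) ^ (q / p) < ∞ :=
      ENNReal.rpow_lt_top_of_nonneg (by positivity) ofNat_ne_top
    exact mul_lt_top (mul_lt_top h4 (mul_lt_top h3 (add_lt_top.2
      ⟨mul_lt_top ofNat_lt_top (two_rpow_ne_top _).lt_top, (two_rpow_ne_top _).lt_top⟩))) h4'
  set A := C₁ a b r p q u v w
  set B := C₃ a b r p q u v w
  set N := ∫⁻ t in Ioo a b, (∫⁻ s in Ioo a t, f s) ^ p * w t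
  have h := lintegral_rpow_mul_le hr0 hr1 hrp hpq hq1 hu.1 hv hw hww (A := A) (B := B)
    (fun x t hax hxt htb => mul_Vr_le_C₁ hr0 hr1 hp hq hu hww hax hxt htb)
    (fun x hx => le_iSup₂ (f := fun x (_ : x ∈ Ioo a b) => (∫⁻ t in Ioo x b, u t) ^ (1 / q) *
      (∫⁻ t in Ioo a x, (∫⁻ s in Ioo t b, w s) ^ (-(p / (p - r))) * w t *
        Vr r v t x ^ (p * r / (p - r))) ^ ((p - r) / (p * r))) x hx) hf
  calc (∫⁻ t in Ioo a b, (∫⁻ s in Ioo a t, f s ^ r * v s) ^ (q / r) * u t) ^ (1 / q)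
      ≤ (4 ^ (q / r) * (3 ^ (q / r) * (2 * (2 ^ (q / p) * (A + B) ^ q) +
          2 ^ (q / r) * (A + B) ^ q)) * (4 * N) ^ (q / p)) ^ (1 / q) := by
        refine ENNReal.rpow_le_rpow (h.trans ?_) (by positivity)
        gcongr
        · exact le_self_add
        · exact le_add_self
    _ = (L * (A + B) ^ q * N ^ (q / p)) ^ (1 / q) := by
        rw [ENNReal.mul_rpow_of_nonneg 4 N (by positivity), hL]
        congr 1
        ring
    _ = L ^ (1 / q) * (A + B) * N ^ (1 / p) := by
        rw [ENNReal.mul_rpow_of_nonneg _ _ (by positivity),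
          ENNReal.mul_rpow_of_nonneg _ _ (by positivity), ← ENNReal.rpow_mul, ← ENNReal.rpow_mul,
          mul_one_div_cancel hq.ne', ENNReal.rpow_one]
        congr 2
        field_simp

section necessity

variable {a b r p q : ℝ} {u v w : ℝ → ℝ≥0∞} {C : ℝ≥0∞}

/-- The inequality tested on functions supported to the left of `t`. -/
lemma CesCesIneq.mul_le (h : CesCesIneq a b r p q u v w C) (hr0 : 0 < r) (hq : 0 < q)
    (hu : Measurable u) {t : ℝ} (hat : a ≤ t) {E : Set ℝ} (hE : MeasurableSet E)
    (hEt : E ⊆ Ioo a t) {f : ℝ → ℝ≥0∞} (hf : Measurable f) :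
    (∫⁻ s in Ioo t b, u s) ^ (1 / q) * (∫⁻ s in E, f s ^ r * v s) ^ (1 / r) ≤
      C * (∫⁻ y in Ioo a b, (∫⁻ s in E ∩ Ioo a y, f s) ^ p * w y) ^ (1 / p) := by
  have h1 := h (E.indicator f) (hf.indicator hE)
  have e1 : ∀ s, E.indicator f s ^ r * v s = E.indicator (fun s => f s ^ r * v s) s := fun s => by
    by_cases hs : s ∈ E <;> simp [hs, hr0]
  simp only [e1, setLIntegral_indicator hE] at h1
  refine le_trans ?_ h1
  calc (∫⁻ s in Ioo t b, u s) ^ (1 / q) * (∫⁻ s in E, f s ^ r * v s) ^ (1 / r)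
      = (∫⁻ y in Ioo t b, (∫⁻ s in E, f s ^ r * v s) ^ (q / r) * u y) ^ (1 / q) := by
        rw [lintegral_const_mul _ hu, ENNReal.mul_rpow_of_nonneg _ _ (by positivity),
          ← ENNReal.rpow_mul, mul_comm]
        congr 2
        field_simp
    _ ≤ (∫⁻ y in Ioo t b, (∫⁻ s in E ∩ Ioo a y, f s ^ r * v s) ^ (q / r) * u y) ^ (1 / q) := by
        refine ENNReal.rpow_le_rpow (setLIntegral_mono' measurableSet_Ioo fun y hy => ?_)
          (by positivity)
        rw [inter_eq_left.2 (hEt.trans (Ioo_subset_Ioo_right hy.1.le))]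
    _ ≤ _ := ENNReal.rpow_le_rpow (lintegral_mono_set (Ioo_subset_Ioo_left hat)) (by positivity)

lemma CesCesIneq.mul_le_of_Ioo (h : CesCesIneq a b r p q u v w C) (hr0 : 0 < r) (hp : 0 < p)
    (hq : 0 < q) (hu : Measurable u) (hw : Measurable w) {x t : ℝ} (hax : a ≤ x) (hxt : x ≤ t)
    {f : ℝ → ℝ≥0∞} (hf : Measurable f) :
    (∫⁻ s in Ioo t b, u s) ^ (1 / q) * (∫⁻ s in Ioo x t, f s ^ r * v s) ^ (1 / r) ≤
      C * (∫⁻ s in Ioo x b, w s) ^ (1 / p) * ∫⁻ s in Ioo x t, f s := by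
  refine (h.mul_le hr0 hq hu (hax.trans hxt) measurableSet_Ioo
    (Ioo_subset_Ioo_left hax) hf).trans ?_
  rw [mul_assoc]
  refine mul_le_mul_right ?_ C
  calc (∫⁻ y in Ioo a b, (∫⁻ s in Ioo x t ∩ Ioo a y, f s) ^ p * w y) ^ (1 / p)
      ≤ (∫⁻ y in Ioo a b, (Ioo x b).indicator
          (fun y => (∫⁻ s in Ioo x t, f s) ^ p * w y) y) ^ (1 / p) := by
        refine ENNReal.rpow_le_rpow (setLIntegral_mono' measurableSet_Ioo fun y hy => ?_)
          (by positivity)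
        rcases le_or_gt y x with hyx | hyx
        · have : Ioo x t ∩ Ioo a y = ∅ :=
            eq_empty_of_forall_notMem fun s hs => (hs.2.2.trans_le hyx).not_gt hs.1.1
          rw [this, Measure.restrict_empty, lintegral_zero_measure, ENNReal.zero_rpow_of_pos hp,
            zero_mul]
          exact zero_le
        · rw [indicator_of_mem (show y ∈ Ioo x b from ⟨hyx, hy.2⟩)]
          exact mul_le_mul_left (ENNReal.rpow_le_rpow
            (lintegral_mono_set inter_subset_left) hp.le) _
    _ ≤ ((∫⁻ s in Ioo x t, f s) ^ p * ∫⁻ s in Ioo x b, w s) ^ (1 / p) := by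
        rw [setLIntegral_indicator measurableSet_Ioo, ← lintegral_const_mul _ hw]
        exact ENNReal.rpow_le_rpow (lintegral_mono_set inter_subset_left) (by positivity)
    _ = _ := by
        rw [ENNReal.mul_rpow_of_nonneg _ _ (by positivity), ← ENNReal.rpow_mul,
          mul_one_div_cancel hp.ne', ENNReal.rpow_one, mul_comm]

lemma CesCesIneq.tail_ne_top (h : CesCesIneq a b r p q u v w C) (hC : C ≠ ∞) (hr0 : 0 < r)
    (hp : 0 < p) (hq : 0 < q) (hu : Measurable u) (hv : IsWeight a b v) (hww : Measurable w)
    (hw : ∀ x ∈ Ioo a b, 0 < (∫⁻ t in Ioo x b, w t) ∧ (∫⁻ t in Ioo x b, w t) < ∞)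
    {t : ℝ} (ht : t ∈ Ioo a b) : ∫⁻ s in Ioo t b, u s ≠ ∞ := by
  intro hU
  obtain ⟨x, hax, hxt⟩ := exists_between ht.1
  have h1 := h.mul_le_of_Ioo hr0 hp hq hu hww hax.le hxt.le (f := 1) measurable_one
  have h2 : 0 < ∫⁻ s in Ioo x t, v s := by
    rw [setLIntegral_pos_iff hv.1]
    have : Function.support v ∩ Ioo x t = Ioo x t :=
      inter_eq_right.2 fun s hs => (hv.2 s ⟨hax.trans hs.1, hs.2.trans ht.2⟩).1.ne'
    rw [this]
    simpa using hxt
  simp only [Pi.one_apply, ENNReal.one_rpow, one_mul, hU, lintegral_one,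
    Measure.restrict_apply_univ, Real.volume_Ioo] at h1
  rw [ENNReal.top_rpow_of_pos (by positivity), ENNReal.top_mul
    (ENNReal.rpow_pos_of_nonneg h2 (by positivity)).ne', top_le_iff] at h1
  exact ENNReal.mul_ne_top (ENNReal.mul_ne_top hC (ENNReal.rpow_ne_top_of_nonneg (by positivity)
    (hw x ⟨hax, hxt.trans ht.2⟩).2.ne)) ENNReal.ofReal_ne_top h1

lemma CesCesIneq.mul_Vr_le (h : CesCesIneq a b r p q u v w C) (hC : C ≠ ∞) (hr0 : 0 < r)
    (hr1 : r ≤ 1) (hp : 0 < p) (hq : 0 < q) (hu : IsWeight a b u) (hv : IsWeight a b v)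
    (hww : Measurable w)
    (hw : ∀ x ∈ Ioo a b, 0 < (∫⁻ t in Ioo x b, w t) ∧ (∫⁻ t in Ioo x b, w t) < ∞)
    {x t : ℝ} (hax : a < x) (hxt : x < t) (htb : t < b) :
    (∫⁻ s in Ioo t b, u s) ^ (1 / q) * Vr r v x t ≤ C * (∫⁻ s in Ioo x b, w s) ^ (1 / p) := by
  have ht : t ∈ Ioo a b := ⟨hax.trans hxt, htb⟩
  have hU0 : (∫⁻ s in Ioo t b, u s) ^ (1 / q) ≠ 0 :=
    (ENNReal.rpow_pos_of_nonneg (tail_weight_pos hu ht) (by positivity)).ne'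
  have hUt : (∫⁻ s in Ioo t b, u s) ^ (1 / q) ≠ ∞ :=
    ENNReal.rpow_ne_top_of_nonneg (by positivity) (h.tail_ne_top hC hr0 hp hq hu.1 hv hww hw ht)
  rw [mul_comm, ← ENNReal.le_div_iff_mul_le (Or.inl hU0) (Or.inl hUt), Vr_eq_vrOn]
  refine vrOn_le_of_forall hr0 hr1 hv.1 measurableSet_Ioo (by simp)
    (fun s hs => (hv.2 s ⟨hax.trans hs.1, hs.2.trans htb⟩).2) fun g hg => ?_
  rw [← ENNReal.mul_div_right_comm,
    ENNReal.le_div_iff_mul_le (Or.inl hU0) (Or.inl hUt), mul_comm]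
  exact h.mul_le_of_Ioo hr0 hp hq hu.1 hww hax.le hxt.le hg

lemma CesCesIneq.C₁_le (h : CesCesIneq a b r p q u v w C) (hr0 : 0 < r)
    (hr1 : r ≤ 1) (hp : 0 < p) (hq : 0 < q) (hu : IsWeight a b u) (hv : IsWeight a b v)
    (hww : Measurable w)
    (hw : ∀ x ∈ Ioo a b, 0 < (∫⁻ t in Ioo x b, w t) ∧ (∫⁻ t in Ioo x b, w t) < ∞) :
    C₁ a b r p q u v w ≤ C := by
  rcases eq_or_ne C ∞ with rfl | hC
  · exact le_top
  refine essSup_le_of_ae_le _ ((ae_restrict_iff' measurableSet_Ioo).2 (.of_forall fun x hx => ?_))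
  have h1 : essSup (fun t => (∫⁻ s in Ioo t b, u s) ^ (1 / q) * Vr r v x t)
      (volume.restrict (Ioo x b)) ≤ C * (∫⁻ s in Ioo x b, w s) ^ (1 / p) :=
    essSup_le_of_ae_le _ ((ae_restrict_iff' measurableSet_Ioo).2 (.of_forall fun t ht =>
      h.mul_Vr_le hC hr0 hr1 hp hq hu hv hww hw hx.1 ht.1 ht.2))
  refine (mul_le_mul_right h1 _).trans (le_of_eq ?_)
  rw [mul_left_comm, ENNReal.rpow_neg, ENNReal.inv_mul_cancel
    (ENNReal.rpow_pos_of_nonneg (hw x hx).1 (by positivity)).ne'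
    (ENNReal.rpow_ne_top_of_nonneg (by positivity) (hw x hx).2.ne), mul_one]

/-- A discrete Hardy inequality. -/
lemma exists_tsum_tsum_rpow_le (hp : 0 < p) : ∃ K : ℝ≥0∞, K < ∞ ∧ ∀ α : ℤ → ℝ≥0∞,
    ∑' n : ℤ, (2 : ℝ≥0∞) ^ (-(n : ℝ)) * (∑' j : ℕ, α (n - j)) ^ p ≤
      K * ∑' n : ℤ, (2 : ℝ≥0∞) ^ (-(n : ℝ)) * α n ^ p := by
  set G : ℝ≥0∞ := ∑' j : ℕ, (2 : ℝ≥0∞) ^ (-(1 / (2 * p) * j)) with hG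
  have hGt : G < ∞ := tsum_two_rpow_neg_lt_top (by positivity)
  refine ⟨G ^ p * ∑' j : ℕ, (2 : ℝ≥0∞) ^ (-((1 : ℝ) / 2 * j)), ENNReal.mul_lt_top
    (ENNReal.rpow_lt_top_of_nonneg hp.le hGt.ne) (tsum_two_rpow_neg_lt_top (by positivity)),
    fun α => ?_⟩
  have h1 : ∀ n : ℤ, (∑' j : ℕ, α (n - j)) ^ p ≤
      G ^ p * ⨆ j : ℕ, 2 ^ ((1 : ℝ) / 2 * j) * α (n - j) ^ p := fun n => by
    refine (ENNReal.rpow_le_rpow (tsum_le_mul_iSup _ (1 / (2 * p))) hp.le).trans ?_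
    rw [ENNReal.mul_rpow_of_nonneg _ _ hp.le]
    refine mul_le_mul_right (le_of_eq ?_) _
    refine ((ENNReal.orderIsoRpow p hp).map_iSup _).trans (iSup_congr fun j => ?_)
    rw [ENNReal.orderIsoRpow_apply, ENNReal.mul_rpow_of_nonneg _ _ hp.le, ← ENNReal.rpow_mul]
    congr 2
    field_simp
  have h2 := tsum_two_rpow_mul_iSup_le (θ := 1) fun m => α (-m) ^ p
  calc ∑' n : ℤ, (2 : ℝ≥0∞) ^ (-(n : ℝ)) * (∑' j : ℕ, α (n - j)) ^ p
      ≤ ∑' n : ℤ, (2 : ℝ≥0∞) ^ (-(n : ℝ)) *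
          (G ^ p * ⨆ j : ℕ, 2 ^ ((1 : ℝ) / 2 * j) * α (n - j) ^ p) :=
        ENNReal.tsum_le_tsum fun n => mul_le_mul_right (h1 n) _
    _ = G ^ p * ∑' n : ℤ, (2 : ℝ≥0∞) ^ ((1 : ℝ) * n) *
          ⨆ j : ℕ, 2 ^ ((1 : ℝ) / 2 * j) * α (-(n + j)) ^ p := by
        rw [← ENNReal.tsum_mul_left, ← (Equiv.neg ℤ).tsum_eq]
        refine tsum_congr fun n => ?_
        simp only [Equiv.neg_apply, one_mul, Int.cast_neg, neg_neg, neg_add, sub_eq_add_neg]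
        ring
    _ ≤ G ^ p * ((∑' j : ℕ, (2 : ℝ≥0∞) ^ (-((1 : ℝ) / 2 * j))) *
          ∑' n : ℤ, (2 : ℝ≥0∞) ^ ((1 : ℝ) * n) * α (-n) ^ p) := mul_le_mul_right h2 _
    _ = _ := by
        rw [← mul_assoc, ← (Equiv.neg ℤ).tsum_eq (fun n : ℤ => (2 : ℝ≥0∞) ^ (-(n : ℝ)) * α n ^ p)]
        simp

/-- A near-extremal function in the definition of `vrOn`. -/
lemma exists_setLIntegral_rpow_mul_ge (hr0 : 0 < r) (hr1 : r ≤ 1) (hv : Measurable v) {E : Set ℝ}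
    (hE : MeasurableSet E) (hE' : volume E ≠ ∞) (hvE : ∀ x ∈ E, v x < ∞)
    (hV : vrOn r v E ≠ ∞) :
    ∃ g : ℝ → ℝ≥0∞, Measurable g ∧ ∫⁻ s in E, g s ≤ 1 ∧
      (vrOn r v E / 2) ^ r ≤ ∫⁻ s in E, g s ^ r * v s := by
  rcases eq_or_ne (vrOn r v E) 0 with h0 | h0
  · refine ⟨0, measurable_zero, by simp, ?_⟩
    rw [h0, ENNReal.zero_div, ENNReal.zero_rpow_of_pos hr0]
    exact zero_le
  have hex : ∃ g : ℝ → ℝ≥0∞, Measurable g ∧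
      vrOn r v E / 2 * ∫⁻ s in E, g s < (∫⁻ s in E, g s ^ r * v s) ^ (1 / r) := by
    by_contra! hcon
    exact (ENNReal.half_lt_self h0 hV).not_ge (vrOn_le_of_forall hr0 hr1 hv hE hE' hvE hcon)
  obtain ⟨g, hg, hlt⟩ := hex
  set c := ∫⁻ s in E, g s with hc
  have hct : c ≠ ∞ := fun hct => by
    rw [hct, ENNReal.mul_top (ENNReal.half_pos h0).ne'] at hlt
    exact not_top_lt hlt
  have hc0 : c ≠ 0 := fun hc0 => by
    have h1 := setLIntegral_rpow_mul_le hr0 hr1 hv hg E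
    rw [← hc, hc0, ENNReal.zero_rpow_of_pos hr0, zero_mul, nonpos_iff_eq_zero] at h1
    rw [h1, ENNReal.zero_rpow_of_pos (by positivity)] at hlt
    exact absurd hlt not_lt_bot
  refine ⟨fun s => c⁻¹ * g s, hg.const_mul _, ?_, ?_⟩
  · rw [lintegral_const_mul _ hg, ← hc, ENNReal.inv_mul_cancel hc0 hct]
  · have h2 := ENNReal.rpow_le_rpow hlt.le hr0.le
    rw [← ENNReal.rpow_mul, one_div_mul_cancel hr0.ne', ENNReal.rpow_one,
      ENNReal.mul_rpow_of_nonneg _ _ hr0.le] at h2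
    calc (vrOn r v E / 2) ^ r = c⁻¹ ^ r * ((vrOn r v E / 2) ^ r * c ^ r) := by
          rw [mul_left_comm, ← ENNReal.mul_rpow_of_nonneg _ _ hr0.le, ENNReal.inv_mul_cancel hc0 hct,
            ENNReal.one_rpow, mul_one]
      _ ≤ c⁻¹ ^ r * ∫⁻ s in E, g s ^ r * v s := by gcongr
      _ = ∫⁻ s in E, (c⁻¹ * g s) ^ r * v s := by
          rw [← lintegral_const_mul (f := fun s => g s ^ r * v s) _ ((hg.pow_const r).mul hv)]
          refine lintegral_congr fun s => ?_
          rw [ENNReal.mul_rpow_of_nonneg _ _ hr0.le, mul_assoc]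

lemma exists_mul_le_of_cesCesIneq (hr0 : 0 < r) (hp : 0 < p) (hq : 0 < q) :
    ∃ K : ℝ≥0∞, K < ∞ ∧ ∀ (a b : ℝ) (u v w : ℝ → ℝ≥0∞) (C : ℝ≥0∞),
      CesCesIneq a b r p q u v w C → Measurable u → Measurable w →
      (∀ x ∈ Ioo a b, 0 < (∫⁻ t in Ioo x b, w t) ∧ (∫⁻ t in Ioo x b, w t) < ∞) →
      ∀ x ∈ Ioo a b, ∀ f : ℝ → ℝ≥0∞, Measurable f →
        (∫⁻ s in Ioo x b, u s) ^ (1 / q) *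
            (∑' n, ∫⁻ s in Ioo a x ∩ tailLevel a b w n, f s ^ r * v s) ^ (1 / r) ≤
          C * (K * ∑' n : ℤ, (2 : ℝ≥0∞) ^ (-(n : ℝ)) *
            (∫⁻ s in Ioo a x ∩ tailLevel a b w n, f s) ^ p) ^ (1 / p) := by
  obtain ⟨K, hK, hardy⟩ := exists_tsum_tsum_rpow_le hp
  refine ⟨K, hK, fun a b u v w C h hu hwm hw x hx f hf => ?_⟩
  rw [← setLIntegral_eq_tsum_tailLevel hw measurableSet_Ioo (Ioo_subset_Ioo_right hx.2.le)]
  refine (h.mul_le hr0 hq hu hx.1.le measurableSet_Ioo subset_rfl hf).trans ?_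
  refine mul_le_mul_right (ENNReal.rpow_le_rpow (le_trans ?_ (hardy _)) (by positivity)) C
  rw [setLIntegral_eq_tsum_tailLevel hw measurableSet_Ioo subset_rfl]
  refine ENNReal.tsum_le_tsum fun n => ?_
  rw [inter_eq_right.2 (tailLevel_subset n)]
  set c := ∑' j : ℕ, ∫⁻ s in Ioo a x ∩ tailLevel a b w (n - j), f s with hc
  calc ∫⁻ y in tailLevel a b w n, (∫⁻ s in Ioo a x ∩ Ioo a y, f s) ^ p * w y
      ≤ ∫⁻ y in tailLevel a b w n, c ^ p * w y := by
        refine setLIntegral_mono' (measurableSet_tailLevel n) fun y hy => ?_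
        refine mul_le_mul_left (ENNReal.rpow_le_rpow ?_ hp.le) _
        have hsub : Ioo a x ∩ Ioo a y ⊆ ⋃ j : ℕ, Ioo a x ∩ tailLevel a b w (n - j) := fun s hs => by
          have hsb : s ∈ Ioo a b := ⟨hs.1.1, hs.1.2.trans hx.2⟩
          obtain ⟨m, hm⟩ := exists_mem_tailLevel hsb (hw s hsb).1 (hw s hsb).2
          have hmn : m ≤ n := by
            by_contra! hnm
            exact (lt_of_mem_tailLevel hnm hy hm).not_gt hs.2.2
          refine mem_iUnion.2 ⟨(n - m).toNat, hs.1, ?_⟩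
          rwa [show n - ((n - m).toNat : ℤ) = m by lia]
        exact (lintegral_mono_set hsub).trans (lintegral_iUnion_le _ _)
    _ = c ^ p * ∫⁻ y in tailLevel a b w n, w y := lintegral_const_mul _ hwm
    _ ≤ c ^ p * 2 ^ (-(n : ℝ)) := by gcongr; exact setLIntegral_tailLevel_le n
    _ = _ := mul_comm _ _

lemma exists_tsum_vrOn_le (hr0 : 0 < r) (hr1 : r ≤ 1) (hrp : r < p) (hq : 0 < q) :
    ∃ K : ℝ≥0∞, K < ∞ ∧ ∀ (a b : ℝ) (u v w : ℝ → ℝ≥0∞) (C : ℝ≥0∞), C ≠ ∞ →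
      CesCesIneq a b r p q u v w C → IsWeight a b u → IsWeight a b v → IsWeight a b w →
      (∀ x ∈ Ioo a b, 0 < (∫⁻ t in Ioo x b, w t) ∧ (∫⁻ t in Ioo x b, w t) < ∞) →
      ∀ x ∈ Ioo a b, (∫⁻ s in Ioo x b, u s) ^ (1 / q) *
        (∑' n : ℤ, (2 : ℝ≥0∞) ^ (r / (p - r) * n) *
          (vrOn r v (Ioo a x ∩ tailLevel a b w n) / 2) ^ (p * r / (p - r))) ^
            ((p - r) / (p * r)) ≤ K * C := by
  have hp : 0 < p := hr0.trans hrp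
  have hpr : 0 < p - r := sub_pos.2 hrp
  obtain ⟨K, hK, hmain⟩ := exists_mul_le_of_cesCesIneq hr0 hp hq
  refine ⟨K ^ (1 / p), ENNReal.rpow_lt_top_of_nonneg (by positivity) hK.ne,
    fun a b u v w C hC h hu hv hww hw x hx => ?_⟩
  set U := (∫⁻ s in Ioo x b, u s) ^ (1 / q) with hU
  have hU0 : U ≠ 0 := (ENNReal.rpow_pos_of_nonneg (tail_weight_pos hu hx) (by positivity)).ne'
  have hUt : U ≠ ∞ :=
    ENNReal.rpow_ne_top_of_nonneg (by positivity) (h.tail_ne_top hC hr0 hp hq hu.1 hv hww.1 hw hx)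
  set E : ℤ → Set ℝ := fun n => Ioo a x ∩ tailLevel a b w n with hE
  have hEm : ∀ n, MeasurableSet (E n) := fun n =>
    measurableSet_Ioo.inter (measurableSet_tailLevel n)
  have hEd : ∀ m n, m ≠ n → E m ∩ E n = ∅ := fun m n hmn => disjoint_iff_inter_eq_empty.1
    ((tailLevel_disjoint hmn).mono inter_subset_right inter_subset_right)
  have hEvol : ∀ n, volume (E n) ≠ ∞ := fun n =>
    ne_top_of_le_ne_top (by simp) (measure_mono (inter_subset_left (s := Ioo a x)))
  have hEv : ∀ n, ∀ s ∈ E n, v s < ∞ := fun n s hs => (hv.2 s hs.2.1).2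
  replace hmain := hmain a b u v w C h hu.1 hww.1 hw x hx
  set V : ℤ → ℝ≥0∞ := fun n => vrOn r v (E n) with hV
  have hVt : ∀ n, V n ≠ ∞ := fun n => by
    have hle : V n ≤ C * (K * 2 ^ (-(n : ℝ))) ^ (1 / p) / U := by
      refine vrOn_le_of_forall hr0 hr1 hv.1 (hEm n) (hEvol n) (hEv n) fun g hg => ?_
      rw [← ENNReal.mul_div_right_comm,
        ENNReal.le_div_iff_mul_le (Or.inl hU0) (Or.inl hUt), mul_comm]
      have h1 := hmain ((E n).indicator g) (hg.indicator (hEm n))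
      have e1 : ∀ s, (E n).indicator g s ^ r * v s =
          (E n).indicator (fun s => g s ^ r * v s) s := fun s => by
        by_cases hs : s ∈ E n <;> simp [hs, hr0]
      simp only [e1, setLIntegral_indicator (hEm n)] at h1
      rw [tsum_eq_single n fun m hm => by rw [hEd n m hm.symm]; simp,
        tsum_eq_single n fun m hm => by rw [hEd n m hm.symm]; simp [hp], inter_self,
        ← mul_assoc, ENNReal.mul_rpow_of_nonneg _ (_ ^ p) (by positivity), ← ENNReal.rpow_mul,
        mul_one_div_cancel hp.ne', ENNReal.rpow_one, ← mul_assoc] at h1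
      exact h1
    refine ne_top_of_le_ne_top (ENNReal.div_ne_top (ENNReal.mul_ne_top hC ?_) hU0) hle
    exact ENNReal.rpow_ne_top_of_nonneg (by positivity)
      (ENNReal.mul_ne_top hK.ne (two_rpow_ne_top _))
  choose g hg hg1 hgV using fun n =>
    exists_setLIntegral_rpow_mul_ge hr0 hr1 hv.1 (hEm n) (hEvol n) (hEv n) (hVt n)
  set c : ℤ → ℝ≥0∞ := fun n => (2 ^ (n : ℝ) * (V n / 2) ^ r) ^ (1 / (p - r)) with hc
  set T : ℤ → ℝ≥0∞ := fun n => 2 ^ (r / (p - r) * n) * (V n / 2) ^ (p * r / (p - r)) with hT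
  have hcp : ∀ n : ℤ, (2 : ℝ≥0∞) ^ (-(n : ℝ)) * c n ^ p = T n := fun n => by
    simp only [hc, hT]
    rw [← ENNReal.rpow_mul, ENNReal.mul_rpow_of_nonneg _ _ (by positivity), ← ENNReal.rpow_mul,
      ← ENNReal.rpow_mul, ← mul_assoc, ← two_rpow_add]
    congr 2 <;> field_simp
    ring
  have hcr : ∀ n : ℤ, c n ^ r * (V n / 2) ^ r = T n := fun n => by
    simp only [hc, hT]
    rw [← ENNReal.rpow_mul, ENNReal.mul_rpow_of_nonneg _ _ (by positivity), ← ENNReal.rpow_mul,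
      ← ENNReal.rpow_mul, mul_assoc, ← ENNReal.rpow_add_of_nonneg _ _ (by positivity) hr0.le]
    congr 2 <;> field_simp
    ring
  have hTt : ∀ n, T n ≠ ∞ := fun n => ENNReal.mul_ne_top (two_rpow_ne_top _)
    (ENNReal.rpow_ne_top_of_nonneg (by positivity) (ENNReal.div_ne_top (hVt n) two_ne_zero))
  have hsum : ∀ s : Finset ℤ, U * (∑ n ∈ s, T n) ^ ((p - r) / (p * r)) ≤ K ^ (1 / p) * C := by
    intro s
    set f : ℝ → ℝ≥0∞ := fun t => ∑ n ∈ s, (E n).indicator (fun t => c n * g n t) t with hf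
    have hfm : Measurable f := Finset.measurable_fun_sum _ fun n _ =>
      ((hg n).const_mul _).indicator (hEm n)
    have hfE : ∀ n, ∀ t ∈ E n, f t = if n ∈ s then c n * g n t else 0 := fun n t ht => by
      simp only [hf]
      rw [← Finset.sum_ite_eq s n fun m => c m * g m t]
      refine Finset.sum_congr rfl fun m _ => ?_
      split_ifs with hmn
      · subst hmn
        exact indicator_of_mem ht _
      · exact indicator_of_notMem (fun hm => (hEd n m hmn).subset ⟨ht, hm⟩) _
    set S := ∑ n ∈ s, T n with hS
    have hS1 : S ≤ ∑' n, ∫⁻ t in E n, f t ^ r * v t := by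
      refine le_trans (Finset.sum_le_sum fun n hn => ?_) (ENNReal.sum_le_tsum s)
      calc T n ≤ c n ^ r * ∫⁻ t in E n, g n t ^ r * v t := by
            rw [← hcr]
            exact mul_le_mul_right (hgV n) _
        _ = ∫⁻ t in E n, f t ^ r * v t := by
            rw [← lintegral_const_mul (f := fun t => g n t ^ r * v t) _
              (((hg n).pow_const r).mul hv.1)]
            refine setLIntegral_congr_fun (hEm n) fun t ht => ?_
            rw [hfE n t ht, if_pos hn, ENNReal.mul_rpow_of_nonneg _ _ hr0.le, mul_assoc]
    have hS2 : ∑' n : ℤ, (2 : ℝ≥0∞) ^ (-(n : ℝ)) * (∫⁻ t in E n, f t) ^ p ≤ S := by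
      rw [tsum_eq_sum (s := s) fun n hn => ?_]
      · refine Finset.sum_le_sum fun n hn => ?_
        rw [← hcp]
        refine mul_le_mul_right (ENNReal.rpow_le_rpow ?_ hp.le) _
        rw [setLIntegral_congr_fun (g := fun t => c n * g n t) (hEm n)
          fun t ht => by rw [hfE n t ht, if_pos hn], lintegral_const_mul _ (hg n)]
        exact mul_le_of_le_one_right' (hg1 n)
      · rw [setLIntegral_congr_fun (g := fun _ => 0) (hEm n)
          fun t ht => by rw [hfE n t ht, if_neg hn]]
        simp [hp]
    have h1 : U * S ^ (1 / r) ≤ K ^ (1 / p) * C * S ^ (1 / p) := by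
      calc U * S ^ (1 / r) ≤ U * (∑' n, ∫⁻ t in E n, f t ^ r * v t) ^ (1 / r) := by gcongr
        _ ≤ _ := hmain f hfm
        _ ≤ C * (K * S) ^ (1 / p) := by gcongr
        _ = _ := by rw [ENNReal.mul_rpow_of_nonneg _ _ (by positivity)]; ring
    rcases eq_or_ne S 0 with h0 | h0
    · rw [h0, ENNReal.zero_rpow_of_pos (by positivity), mul_zero]
      exact zero_le
    have hSt : S ≠ ∞ := ENNReal.sum_ne_top.2 fun n _ => hTt n
    have e : (1 : ℝ) / r = (p - r) / (p * r) + 1 / p := by field_simp; ring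
    rw [e, ENNReal.rpow_add _ _ h0 hSt, ← mul_assoc] at h1
    exact (ENNReal.mul_le_mul_iff_left
      (ENNReal.rpow_pos_of_nonneg (pos_iff_ne_zero.2 h0) (by positivity)).ne'
      (ENNReal.rpow_ne_top_of_nonneg (by positivity) hSt)).1 h1
  have hexp : 0 < (p - r) / (p * r) := by positivity
  rw [ENNReal.tsum_eq_iSup_sum]
  refine (congrArg (U * ·) ((ENNReal.orderIsoRpow _ hexp).map_iSup _)).trans_le ?_
  rw [ENNReal.mul_iSup]
  exact iSup_le hsum

lemma exists_C₃_le (hr0 : 0 < r) (hr1 : r ≤ 1) (hrp : r < p) (hq : 0 < q) :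
    ∃ K : ℝ≥0∞, K < ∞ ∧ ∀ (a b : ℝ) (u v w : ℝ → ℝ≥0∞) (C : ℝ≥0∞), C ≠ ∞ →
      CesCesIneq a b r p q u v w C → IsWeight a b u → IsWeight a b v → IsWeight a b w →
      (∀ x ∈ Ioo a b, 0 < (∫⁻ t in Ioo x b, w t) ∧ (∫⁻ t in Ioo x b, w t) < ∞) →
      C₃ a b r p q u v w ≤ K * C := by
  have hp : 0 < p := hr0.trans hrp
  have hpr : 0 < p - r := sub_pos.2 hrp
  set θ := r / (p - r) with hθ
  set ρ := p * r / (p - r) with hρ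
  have hθ0 : 0 < θ := by positivity
  have hρ0 : 0 < ρ := by positivity
  obtain ⟨K, hK, hmain⟩ := exists_tsum_vrOn_le hr0 hr1 hrp hq
  obtain ⟨K', hK', hunion⟩ := exists_vrOn_iUnion_le hr0 hr1 (ε := θ / 2 / ρ) (by positivity)
  set G : ℝ≥0∞ := ∑' j : ℕ, (2 : ℝ≥0∞) ^ (-(θ / 2 * j)) with hG
  have hGt : G < ∞ := tsum_two_rpow_neg_lt_top (by positivity)
  set L : ℝ≥0∞ := 2 ^ (p / (p - r)) * K' ^ ρ * G * 2 ^ ρ with hL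
  have hLt : L ≠ ∞ := ENNReal.mul_ne_top (ENNReal.mul_ne_top (ENNReal.mul_ne_top (two_rpow_ne_top _)
    (ENNReal.rpow_ne_top_of_nonneg hρ0.le hK'.ne)) hGt.ne) (two_rpow_ne_top _)
  have hinv : (p - r) / (p * r) = 1 / ρ := (one_div_div _ _).symm
  refine ⟨L ^ (1 / ρ) * K, ENNReal.mul_lt_top
    (ENNReal.rpow_lt_top_of_nonneg (by positivity) hLt) hK,
    fun a b u v w C hC h hu hv hww hw => iSup₂_le fun x hx => ?_⟩
  set E : ℤ → Set ℝ := fun n => Ioo a x ∩ tailLevel a b w n with hE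
  set V : ℤ → ℝ≥0∞ := fun n => vrOn r v (E n) with hV
  have hpiece : ∀ n : ℤ, ∫⁻ t in E n, (∫⁻ s in Ioo t b, w s) ^ (-(p / (p - r))) * w t *
      Vr r v t x ^ ρ ≤ 2 ^ (p / (p - r)) * K' ^ ρ *
        (2 ^ (θ * n) * ⨆ j : ℕ, 2 ^ (θ / 2 * j) * V (n + j) ^ ρ) := by
    intro n
    set Z : ℝ≥0∞ := ⨆ j : ℕ, 2 ^ (θ / 2 * j) * V (n + j) ^ ρ with hZ
    have hVr : ∀ t ∈ E n, Vr r v t x ^ ρ ≤ K' ^ ρ * Z := fun t ht => by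
      have hsub : Ioo t x ⊆ ⋃ j : ℕ, E (n + j) := fun s hs => by
        have hsx : s ∈ Ioo a x := ⟨ht.1.1.trans hs.1, hs.2⟩
        have hsb : s ∈ Ioo a b := ⟨hsx.1, hsx.2.trans hx.2⟩
        obtain ⟨m, hm⟩ := exists_mem_tailLevel hsb (hw s hsb).1 (hw s hsb).2
        have hnm : n ≤ m := by
          by_contra! hmn
          exact (lt_of_mem_tailLevel hmn hm ht.2).not_gt hs.1
        refine mem_iUnion.2 ⟨(m - n).toNat, hsx, ?_⟩
        rwa [show n + ((m - n).toNat : ℤ) = m by lia]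
      refine (ENNReal.rpow_le_rpow ((vrOn_mono hr0 hr1 hsub).trans (hunion v _)) hρ0.le).trans ?_
      rw [ENNReal.mul_rpow_of_nonneg _ _ hρ0.le]
      refine mul_le_mul_right (le_of_eq ?_) _
      refine ((ENNReal.orderIsoRpow ρ hρ0).map_iSup _).trans (iSup_congr fun j => ?_)
      rw [ENNReal.orderIsoRpow_apply, ENNReal.mul_rpow_of_nonneg _ _ hρ0.le, ← ENNReal.rpow_mul]
      congr 2
      rw [mul_right_comm, div_mul_cancel₀ _ hρ0.ne']
    have hW : ∀ t ∈ E n, (∫⁻ s in Ioo t b, w s) ^ (-(p / (p - r))) ≤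
        2 ^ (((n : ℝ) + 1) * (p / (p - r))) := fun t ht => by
      have h2 := ENNReal.rpow_le_rpow (z := p / (p - r))
        (ENNReal.inv_le_inv.2 ht.2.2.1.le) (by positivity)
      rw [← ENNReal.rpow_neg, ← ENNReal.rpow_mul] at h2
      rw [ENNReal.rpow_neg, ← ENNReal.inv_rpow]
      refine h2.trans (le_of_eq ?_)
      congr 1
      ring
    calc ∫⁻ t in E n, (∫⁻ s in Ioo t b, w s) ^ (-(p / (p - r))) * w t * Vr r v t x ^ ρ
        ≤ ∫⁻ t in E n, 2 ^ (((n : ℝ) + 1) * (p / (p - r))) * (K' ^ ρ * Z) * w t := by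
          refine setLIntegral_mono' (measurableSet_Ioo.inter (measurableSet_tailLevel n))
            fun t ht => ?_
          rw [mul_right_comm]
          exact mul_le_mul_left (mul_le_mul' (hW t ht) (hVr t ht)) _
      _ = 2 ^ (((n : ℝ) + 1) * (p / (p - r))) * (K' ^ ρ * Z) * ∫⁻ t in E n, w t :=
          lintegral_const_mul _ hww.1
      _ ≤ 2 ^ (((n : ℝ) + 1) * (p / (p - r))) * (K' ^ ρ * Z) * 2 ^ (-(n : ℝ)) := by
          gcongr
          exact (lintegral_mono_set inter_subset_right).trans (setLIntegral_tailLevel_le n)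
      _ = 2 ^ (p / (p - r)) * K' ^ ρ * (2 ^ (θ * n) * Z) := by
          have e : ((n : ℝ) + 1) * (p / (p - r)) + -(n : ℝ) = p / (p - r) + θ * n := by
            rw [hθ]; field_simp; ring
          rw [mul_right_comm, ← two_rpow_add, e, two_rpow_add]
          ring
  have hCint : ∫⁻ t in Ioo a x, (∫⁻ s in Ioo t b, w s) ^ (-(p / (p - r))) * w t *
      Vr r v t x ^ ρ ≤ L * ∑' n : ℤ, 2 ^ (θ * n) * (V n / 2) ^ ρ := by
    rw [setLIntegral_eq_tsum_tailLevel hw measurableSet_Ioo (Ioo_subset_Ioo_right hx.2.le)]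
    have e : ∀ n : ℤ, (2 : ℝ≥0∞) ^ (θ * n) * V n ^ ρ =
        2 ^ ρ * (2 ^ (θ * n) * (V n / 2) ^ ρ) := fun n => by
      rw [mul_left_comm, ← ENNReal.mul_rpow_of_nonneg _ _ hρ0.le,
        ENNReal.mul_div_cancel two_ne_zero ofNat_ne_top]
    calc _ ≤ ∑' n : ℤ, 2 ^ (p / (p - r)) * K' ^ ρ *
          (2 ^ (θ * n) * ⨆ j : ℕ, 2 ^ (θ / 2 * j) * V (n + j) ^ ρ) :=
          ENNReal.tsum_le_tsum hpiece
      _ ≤ 2 ^ (p / (p - r)) * K' ^ ρ * (G * ∑' n : ℤ, 2 ^ (θ * n) * V n ^ ρ) := by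
          rw [ENNReal.tsum_mul_left]
          exact mul_le_mul_right (tsum_two_rpow_mul_iSup_le _) _
      _ = _ := by
          simp only [e]
          rw [ENNReal.tsum_mul_left, hL]
          ring
  rw [hinv] at hmain ⊢
  calc _ ≤ (∫⁻ t in Ioo x b, u t) ^ (1 / q) *
        (L * ∑' n : ℤ, 2 ^ (θ * n) * (V n / 2) ^ ρ) ^ (1 / ρ) := by gcongr
    _ = L ^ (1 / ρ) * ((∫⁻ t in Ioo x b, u t) ^ (1 / q) *
        (∑' n : ℤ, 2 ^ (θ * n) * (V n / 2) ^ ρ) ^ (1 / ρ)) := by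
        rw [ENNReal.mul_rpow_of_nonneg _ _ (by positivity)]
        ring
    _ ≤ L ^ (1 / ρ) * (K * C) := mul_le_mul_right (hmain a b u v w C hC h hu hv hww hw x hx) _
    _ = _ := (mul_assoc _ _ _).symm

end necessity

/-- case (iii) of the main theorem: for `r < p ≤ q`, `r ≤ 1 ≤ q`,
the inequality holds iff `C₁ < ∞` and `C₃ < ∞`, and `C ≈ C₁ + C₃`. -/
theorem main_case_iii (p q r : ℝ) (hr0 : 0 < r) (hrp : r < p) (hpq : p ≤ q)
    (hr1 : r ≤ 1) (hq1 : 1 ≤ q) :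
    ∃ κ₁ κ₂ : ℝ≥0∞, 0 < κ₁ ∧ κ₂ < ∞ ∧
    ∀ (a b : ℝ), a < b → ∀ u v w : ℝ → ℝ≥0∞,
      IsWeight a b u → IsWeight a b v → IsWeight a b w →
      (∀ x ∈ Set.Ioo a b,
        0 < (∫⁻ t in Set.Ioo x b, w t) ∧ (∫⁻ t in Set.Ioo x b, w t) < ∞) →
      (((∃ C : ℝ≥0∞, C < ∞ ∧ CesCesIneq a b r p q u v w C) ↔
          (C₁ a b r p q u v w < ∞ ∧ C₃ a b r p q u v w < ∞)) ∧
        κ₁ * (C₁ a b r p q u v w + C₃ a b r p q u v w) ≤ BestC a b r p q u v w ∧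
        BestC a b r p q u v w ≤ κ₂ * (C₁ a b r p q u v w + C₃ a b r p q u v w)) := by
  have hp : 0 < p := hr0.trans hrp
  have hq : 0 < q := hp.trans_le hpq
  obtain ⟨κ, hκ, hsuff⟩ := exists_cesCesIneq hr0 hrp hpq hr1 hq1
  obtain ⟨K, hK, hnec⟩ := exists_C₃_le hr0 hr1 hrp hq
  refine ⟨(1 + K)⁻¹, κ, ENNReal.inv_pos.2 (ENNReal.add_ne_top.2 ⟨one_ne_top, hK.ne⟩), hκ,
    fun a b _ u v w hu hv hw hww => ?_⟩
  have hlower : ∀ C, CesCesIneq a b r p q u v w C →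
      C₁ a b r p q u v w + C₃ a b r p q u v w ≤ (1 + K) * C := fun C hC => by
    rcases eq_or_ne C ∞ with rfl | hCt
    · rw [ENNReal.mul_top (by simp)]
      exact le_top
    · rw [add_mul, one_mul]
      exact add_le_add (hC.C₁_le hr0 hr1 hp hq hu hv hw.1 hww) (hnec a b u v w C hCt hC hu hv hw hww)
  have hupper := hsuff a b u v w hu hv hw hww
  refine ⟨⟨fun ⟨C, hCt, hC⟩ => ?_, fun ⟨h₁, h₃⟩ =>
    ⟨_, ENNReal.mul_lt_top hκ (ENNReal.add_lt_top.2 ⟨h₁, h₃⟩), hupper⟩⟩,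
    le_sInf fun C hC => ?_, sInf_le hupper⟩
  · exact ENNReal.add_lt_top.1 ((hlower C hC).trans_lt
      (ENNReal.mul_lt_top (ENNReal.add_lt_top.2 ⟨one_lt_top, hK⟩) hCt))
  · rw [mul_comm, ← div_eq_mul_inv]
    exact ENNReal.div_le_of_le_mul' (hlower C hC)
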